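/- arXiv:1402.2918 — 8 statements merged into one kernel-verified Lean document; each statement's English description precedes it below -/
import Mathlib

section
/- Let 𝒯 ⊆ (0,1) and let X = (X(t))_{t∈𝒯} be a stochastic process satisfying Condition (C) with constant M ≥ 1 and function L, and assume all suprema of X over sets of the form [ℓ(a), ℓ(a+c)] ∩ 𝒯 and over 𝒯 are measurable. Then for arbitrary ν > 1 and L₀ ∈ (0,1) there exists a real constant M₀ ≥ 1 such that P( sup_{t∈𝒯} ( X(t) − C(t) − ν·D(t) ) > η ) ≤ M₀·exp(−L₀·η) for all η ≥ 0. -/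
open MeasureTheory Filter Set

/-- The logistic function ℓ(x) = eˣ/(1+eˣ). -/
noncomputable def logistic (x : ℝ) : ℝ := Real.exp x / (1 + Real.exp x)

/-- C(t) = log log ( e / (4 t (1−t)) ). -/
noncomputable def Cfun (t : ℝ) : ℝ := Real.log (Real.log (Real.exp 1 / (4 * t * (1 - t))))

/-- D(t) = log (1 + C(t)²). -/
noncomputable def Dfun (t : ℝ) : ℝ := Real.log (1 + Cfun t ^ 2)

lemma logistic_pos (x : ℝ) : 0 < logistic x := by
  unfold logistic
  positivity

lemma logistic_mono : Monotone logistic := by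
  intro x y hxy
  have h := Real.exp_le_exp.2 hxy
  unfold logistic
  rw [div_le_div_iff₀ (by positivity) (by positivity)]
  nlinarith

lemma exists_logistic_eq {t : ℝ} (ht : t ∈ Set.Ioo (0 : ℝ) 1) : ∃ x, logistic x = t := by
  have h1 : 0 < 1 - t := sub_pos.2 ht.2
  refine ⟨Real.log (t / (1 - t)), ?_⟩
  unfold logistic
  rw [Real.exp_log (div_pos ht.1 h1)]
  field_simp
  ring

lemma one_sub_logistic (x : ℝ) : 1 - logistic x = 1 / (1 + Real.exp x) := by
  unfold logistic
  field_simp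
  ring

lemma logistic_mul_one_sub_le (x : ℝ) :
    logistic x * (1 - logistic x) ≤ Real.exp (-|x|) := by
  have he := Real.exp_pos x
  have h : logistic x * (1 - logistic x) = Real.exp x / (1 + Real.exp x) ^ 2 := by
    rw [one_sub_logistic, logistic]
    field_simp
  rw [h, div_le_iff₀ (by positivity)]
  rcases abs_cases x with ⟨hx, -⟩ | ⟨hx, -⟩
  · rw [hx, Real.exp_neg, inv_mul_eq_div, le_div_iff₀ he]
    nlinarith
  · rw [hx, neg_neg]
    nlinarith [mul_pos he he, mul_pos (mul_pos he he) he]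

/-- A lower bound for `C` in the logistic parametrization. -/
lemma posLog_le_Cfun_logistic {x m : ℝ} (hm : 0 < m) (hmx : m ≤ |x| + 2) :
    Real.posLog (m / 4) ≤ Cfun (logistic x) := by
  have h0 : 0 < logistic x * (1 - logistic x) := by
    refine mul_pos (logistic_pos x) ?_
    rw [one_sub_logistic]
    positivity
  set p := logistic x * (1 - logistic x) with hp
  have hlog : Real.log (Real.exp 1 / (4 * logistic x * (1 - logistic x)))
      = 1 - Real.log 4 - Real.log p := by
    rw [mul_assoc, Real.log_div (Real.exp_pos 1).ne' (by positivity), Real.log_exp,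
      Real.log_mul (by norm_num) h0.ne']
    ring
  have h1 : Real.log 4 + Real.log p ≤ 0 := by
    rw [← Real.log_mul (by norm_num) h0.ne']
    refine Real.log_nonpos (by positivity) ?_
    nlinarith [sq_nonneg (2 * logistic x - 1)]
  have h2 : Real.log p ≤ -|x| := by
    rw [Real.log_le_iff_le_exp h0]
    exact logistic_mul_one_sub_le x
  have h4 : Real.log 4 = 2 * Real.log 2 := by
    rw [show (4 : ℝ) = 2 ^ 2 by norm_num, Real.log_pow]
    norm_num
  have h5 := Real.log_two_lt_d9
  unfold Cfun
  rw [hlog, Real.posLog_def]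
  refine max_le (Real.log_nonneg (by linarith)) (Real.log_le_log (by positivity) ?_)
  rcases le_total |x| 2 with h | h <;> linarith

lemma rpow_le_two_rpow_mul {s : ℝ} (hs : 0 < s) (k : ℕ) :
    (1 + Real.posLog ((2 : ℝ) ^ (k + 4) / 4) ^ 2) ^ (-s)
      ≤ 2 ^ (2 * s) * ((k : ℝ) + 1) ^ (-(2 * s)) := by
  have hu : ((k : ℝ) + 1) / 2 ≤ Real.posLog ((2 : ℝ) ^ (k + 4) / 4) := by
    rw [Real.posLog_def]
    refine le_max_of_le_right ?_
    beta_reduce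
    rw [show (2 : ℝ) ^ (k + 4) / 4 = 2 ^ (k + 2) by ring, Real.log_pow]
    push_cast
    have := Real.log_two_gt_d9
    nlinarith [(Nat.cast_nonneg k : (0 : ℝ) ≤ k)]
  have hk : (0 : ℝ) < ((k : ℝ) + 1) / 2 := by positivity
  calc (1 + Real.posLog ((2 : ℝ) ^ (k + 4) / 4) ^ 2) ^ (-s)
      ≤ ((((k : ℝ) + 1) / 2) ^ 2) ^ (-s) := by
        refine Real.rpow_le_rpow_of_nonpos (by positivity) ?_ (by linarith)
        nlinarith
    _ = 2 ^ (2 * s) * ((k : ℝ) + 1) ^ (-(2 * s)) := by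
        rw [← Real.rpow_natCast, ← Real.rpow_mul hk.le, Real.div_rpow (by positivity) (by norm_num)]
        push_cast
        rw [mul_neg, Real.rpow_neg (by norm_num : (0 : ℝ) ≤ 2), div_inv_eq_mul, mul_comm]

lemma summable_inv_mul_posLog_rpow {s : ℝ} (hs : 1 / 2 < s) :
    Summable fun n : ℕ => (n : ℝ)⁻¹ * (1 + Real.posLog ((n : ℝ) / 4) ^ 2) ^ (-s) := by
  rw [← summable_condensed_iff_of_nonneg]
  · rw [← summable_nat_add_iff 4]
    have hsum : Summable fun k : ℕ => (2 : ℝ) ^ (2 * s) * ((k : ℝ) + 1) ^ (-(2 * s)) := by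
      have h := (summable_nat_add_iff 1).2 (Real.summable_nat_rpow.2 (by linarith : -(2 * s) < -1))
      simpa using h.mul_left ((2 : ℝ) ^ (2 * s))
    refine Summable.of_nonneg_of_le (fun k => by positivity) (fun k => ?_) hsum
    push_cast
    rw [mul_inv_cancel_left₀ (by positivity)]
    exact rpow_le_two_rpow_mul (by linarith) k
  · intro n
    positivity
  · intro m n hm hmn
    have hm' : (0 : ℝ) < m := by exact_mod_cast hm
    have hmn' : (m : ℝ) ≤ n := by exact_mod_cast hmn
    have hlog : Real.posLog ((m : ℝ) / 4) ≤ Real.posLog ((n : ℝ) / 4) :=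
      Real.monotoneOn_posLog (Set.mem_Ici.2 (by positivity)) (Set.mem_Ici.2 (by positivity))
        (by linarith)
    have h0 : 0 ≤ Real.posLog ((m : ℝ) / 4) := Real.posLog_nonneg
    refine mul_le_mul (inv_anti₀ hm' hmn') ?_ (by positivity) (by positivity)
    exact Real.rpow_le_rpow_of_nonpos (by positivity) (by gcongr) (by linarith)

lemma summable_int_natAbs_add_one {f : ℕ → ℝ} (hf : Summable f) :
    Summable fun j : ℤ => f (j.natAbs + 1) := by
  have h := (summable_nat_add_iff 1).2 hf
  refine Summable.of_nat_of_neg ?_ ?_ <;> simpa using h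

lemma log_one_add_sq_le {u : ℝ} (hu : 0 ≤ u) : Real.log (1 + u ^ 2) ≤ 2 * u := by
  rw [Real.log_le_iff_le_exp (by positivity), two_mul, Real.exp_add]
  nlinarith [Real.add_one_le_exp u]

lemma two_add_le_mul_rpow_half (u : ℝ) : 2 + u ≤ 3 * (1 + u ^ 2) ^ (1 / 2 : ℝ) := by
  rw [← Real.sqrt_eq_rpow]
  have h : 0 ≤ Real.sqrt (1 + u ^ 2) := Real.sqrt_nonneg _
  have h2 : Real.sqrt (1 + u ^ 2) ^ 2 = 1 + u ^ 2 := Real.sq_sqrt (by positivity)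
  nlinarith [sq_nonneg (u - 1)]

/-- The expected weight of one block of `2 + log⁺ (m / 4)` cells. -/
lemma two_add_mul_exp_le {m ν : ℝ} (hm : 0 < m) :
    (2 + Real.posLog (m / 4)) *
        Real.exp (-(Real.posLog (m / 4) + ν * Real.log (1 + Real.posLog (m / 4) ^ 2)))
      ≤ 12 * (m⁻¹ * (1 + Real.posLog (m / 4) ^ 2) ^ (-(ν - 1 / 2))) := by
  have h1 : Real.exp (-Real.posLog (m / 4)) ≤ 4 * m⁻¹ := by
    have h : Real.log (m / 4) ≤ Real.posLog (m / 4) := by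
      rw [Real.posLog_def]
      exact le_max_right _ _
    calc Real.exp (-Real.posLog (m / 4)) ≤ Real.exp (-Real.log (m / 4)) :=
          Real.exp_le_exp.2 (by linarith)
      _ = 4 * m⁻¹ := by
          rw [Real.exp_neg, Real.exp_log (by positivity), inv_div, div_eq_mul_inv]
  set u := Real.posLog (m / 4)
  have hq : 0 < 1 + u ^ 2 := by positivity
  have h2 : Real.exp (-(ν * Real.log (1 + u ^ 2))) = (1 + u ^ 2) ^ (-ν) := by
    rw [Real.rpow_def_of_pos hq]
    congr 1
    ring
  rw [neg_add, Real.exp_add, h2]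
  calc (2 + u) * (Real.exp (-u) * (1 + u ^ 2) ^ (-ν))
      ≤ 3 * (1 + u ^ 2) ^ (1 / 2 : ℝ) * (4 * m⁻¹ * (1 + u ^ 2) ^ (-ν)) := by
        gcongr
        exact two_add_le_mul_rpow_half u
    _ = 12 * (m⁻¹ * ((1 + u ^ 2) ^ (1 / 2 : ℝ) * (1 + u ^ 2) ^ (-ν))) := by ring
    _ = 12 * (m⁻¹ * (1 + u ^ 2) ^ (-(ν - 1 / 2))) := by
        rw [← Real.rpow_add hq]
        congr 3
        ring

/-- A unit interval splits into `n` cells of length `1 / n`. -/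
lemma exists_cell {x y : ℝ} {n : ℕ} (hn : 0 < n) (hx : y ≤ x) (hxy : x < y + 1) :
    ∃ i ∈ Finset.range n, y + i / n ≤ x ∧ x ≤ y + i / n + 1 / n := by
  have hn' : (0 : ℝ) < n := by exact_mod_cast hn
  have h0 : 0 ≤ (x - y) * n := mul_nonneg (by linarith) hn'.le
  have h1 := Nat.floor_le h0
  have h2 := Nat.lt_floor_add_one ((x - y) * n)
  refine ⟨⌊(x - y) * n⌋₊, Finset.mem_range.2 ((Nat.floor_lt h0).2 (by nlinarith)), ?_, ?_⟩
  · have := (div_le_iff₀ hn').2 h1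
    linarith
  · have := (le_div_iff₀ hn').2 h2.le
    rw [add_div] at this
    linarith

/-- The tail of the weighted process on a logistic block `[ℓ(y), ℓ(y+1))` on which `C ≥ u`,
when the block is split into `n` cells. -/
lemma measure_block_le {Ω : Type*} [MeasurableSpace Ω] {P : Measure Ω} {T : Set ℝ}
    {X : ℝ → Ω → ℝ} {M : ℝ} (hM : 0 ≤ M) {L : ℝ → ℝ}
    (hC : ∀ a c : ℝ, 0 ≤ c → ∀ η : ℝ,
      P {ω | ∃ t ∈ Set.Icc (logistic a) (logistic (a + c)) ∩ T, η < X t ω}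
        ≤ ENNReal.ofReal (M * Real.exp (-(L c * η))))
    {ν L₀ u B y η : ℝ} {n : ℕ} (hν : 0 ≤ ν) (hu : 0 ≤ u) (hη : 0 ≤ η) (hn : 0 < n)
    (hCu : ∀ x, y ≤ x → x < y + 1 → u ≤ Cfun (logistic x))
    (hL : L₀ ≤ L (1 / n))
    (hB : (1 - L (1 / n)) * (u + ν * Real.log (1 + u ^ 2)) ≤ B) :
    P {ω | ∃ x, logistic x ∈ T ∧ y ≤ x ∧ x < y + 1 ∧
        η < X (logistic x) ω - Cfun (logistic x) - ν * Dfun (logistic x)}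
      ≤ ENNReal.ofReal (n * (M * Real.exp B * Real.exp (-(u + ν * Real.log (1 + u ^ 2))) *
          Real.exp (-(L₀ * η)))) := by
  set b := u + ν * Real.log (1 + u ^ 2) with hb
  have hsub : {ω | ∃ x, logistic x ∈ T ∧ y ≤ x ∧ x < y + 1 ∧
        η < X (logistic x) ω - Cfun (logistic x) - ν * Dfun (logistic x)} ⊆
      ⋃ i ∈ Finset.range n, {ω | ∃ t ∈ Set.Icc (logistic (y + i / n))
        (logistic (y + i / n + 1 / n)) ∩ T, η + b < X t ω} := by
    rintro ω ⟨x, hxT, hyx, hxy, hX⟩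
    obtain ⟨i, hi, h1, h2⟩ := exists_cell hn hyx hxy
    refine Set.mem_iUnion₂.2 ⟨i, hi, logistic x, ⟨⟨logistic_mono h1, logistic_mono h2⟩, hxT⟩, ?_⟩
    have hCx := hCu x hyx hxy
    have hD : ν * Real.log (1 + u ^ 2) ≤ ν * Dfun (logistic x) := by
      unfold Dfun
      gcongr
    linarith
  calc P _ ≤ ∑ i ∈ Finset.range n, P {ω | ∃ t ∈ Set.Icc (logistic (y + i / n))
        (logistic (y + i / n + 1 / n)) ∩ T, η + b < X t ω} :=
        (measure_mono hsub).trans (measure_biUnion_finset_le _ _)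
    _ ≤ ∑ _i ∈ Finset.range n,
        ENNReal.ofReal (M * Real.exp B * Real.exp (-b) * Real.exp (-(L₀ * η))) := by
        refine Finset.sum_le_sum fun i _ => (hC _ _ (by positivity) _).trans ?_
        refine ENNReal.ofReal_le_ofReal ?_
        rw [mul_assoc, mul_assoc, ← Real.exp_add, ← Real.exp_add]
        gcongr
        nlinarith
    _ = _ := by
        rw [Finset.sum_const, Finset.card_range, nsmul_eq_mul,
          ENNReal.ofReal_mul (Nat.cast_nonneg n), ENNReal.ofReal_natCast]

/-- Theorem (general non-Gaussian LIL, Dümbgen–Wellner Theorem 2.1):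
if the process `X` on `T ⊆ (0,1)` has locally uniformly subexponential tails
(Condition (C) with constant `M ≥ 1` and non-increasing `L : [0,∞) → [0,1]`,
`L(c) = 1 − O(c)` as `c ↓ 0`), then for any `ν > 1` and `L₀ ∈ (0,1)` there is
`M₀ ≥ 1` with `P(sup_{t ∈ T} (X(t) − C(t) − ν D(t)) > η) ≤ M₀ exp(−L₀ η)` for all `η ≥ 0`.
(The event `sup > η` is expressed by the equivalent `∃ t, X t > η`, which also
encodes the convention that the supremum over the empty set is `−∞`.) -/
theorem stmt0
    {Ω : Type*} [MeasurableSpace Ω] (P : Measure Ω) [IsProbabilityMeasure P]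
    (T : Set ℝ) (hT : T ⊆ Set.Ioo 0 1)
    (X : ℝ → Ω → ℝ)
    (M : ℝ) (hM : 1 ≤ M)
    (L : ℝ → ℝ)
    (hLanti : ∀ c₁ c₂ : ℝ, 0 ≤ c₁ → c₁ ≤ c₂ → L c₂ ≤ L c₁)
    (hLrange : ∀ c : ℝ, 0 ≤ c → L c ∈ Set.Icc (0:ℝ) 1)
    (hLnear : ∃ K₀ > (0:ℝ), ∃ c₀ > (0:ℝ), ∀ c : ℝ, 0 ≤ c → c ≤ c₀ → 1 - K₀ * c ≤ L c)
    (hmeas : ∀ a c η : ℝ, MeasurableSet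
      {ω | ∃ t ∈ Set.Icc (logistic a) (logistic (a + c)) ∩ T, η < X t ω})
    (hC : ∀ a c : ℝ, 0 ≤ c → ∀ η : ℝ,
      P {ω | ∃ t ∈ Set.Icc (logistic a) (logistic (a + c)) ∩ T, η < X t ω}
        ≤ ENNReal.ofReal (M * Real.exp (-(L c * η))))
    (ν L₀ : ℝ) (hν : 1 < ν) (hL₀ : L₀ ∈ Set.Ioo (0:ℝ) 1)
    (hmeasT : ∀ η : ℝ, MeasurableSet {ω | ∃ t ∈ T, η < X t ω - Cfun t - ν * Dfun t}) :
    ∃ M₀ : ℝ, 1 ≤ M₀ ∧ ∀ η : ℝ, 0 ≤ η →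
      P {ω | ∃ t ∈ T, η < X t ω - Cfun t - ν * Dfun t}
        ≤ ENNReal.ofReal (M₀ * Real.exp (-(L₀ * η))) := by
  obtain ⟨K₀, hK₀, c₀, hc₀, hL⟩ := hLnear
  obtain ⟨N, hN⟩ := exists_nat_gt (max 1 (max (1 / c₀) (K₀ / (1 - L₀))))
  simp only [max_lt_iff] at hN
  obtain ⟨hN1, hNc, hNL⟩ := hN
  have hL₀' : 0 < 1 - L₀ := sub_pos.2 hL₀.2
  rw [div_lt_iff₀ hc₀] at hNc
  rw [div_lt_iff₀ hL₀'] at hNL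
  let m : ℤ → ℕ := fun j => j.natAbs + 1
  let u : ℤ → ℝ := fun j => Real.posLog ((m j : ℝ) / 4)
  let n : ℤ → ℕ := fun j => N * ⌈1 + u j⌉₊
  let B : ℝ := K₀ * (1 + 2 * ν)
  let f : ℕ → ℝ := fun k => (k : ℝ)⁻¹ * (1 + Real.posLog ((k : ℝ) / 4) ^ 2) ^ (-(ν - 1 / 2))
  let A : ℝ := N * M * Real.exp B * 12
  have hu : ∀ j, 0 ≤ u j := fun j => Real.posLog_nonneg
  have hf : Summable fun j : ℤ => f (m j) :=
    summable_int_natAbs_add_one (summable_inv_mul_posLog_rpow (by linarith))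
  have hf0 : ∀ k, 0 ≤ f k := fun k => by positivity
  have hA : 0 ≤ A := by positivity
  have hblock : ∀ (j : ℤ) (η : ℝ), 0 ≤ η →
      P {ω | ∃ x, logistic x ∈ T ∧ (j : ℝ) ≤ x ∧ x < j + 1 ∧
        η < X (logistic x) ω - Cfun (logistic x) - ν * Dfun (logistic x)}
      ≤ ENNReal.ofReal (A * f (m j) * Real.exp (-(L₀ * η))) := by
    intro j η hη
    have hmj : (m j : ℝ) = |(j : ℝ)| + 1 := by
      simp [m, Nat.cast_natAbs]
    have hceil : 1 + u j ≤ (⌈1 + u j⌉₊ : ℝ) := Nat.le_ceil _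
    have hceil' : (⌈1 + u j⌉₊ : ℝ) < 1 + u j + 1 := Nat.ceil_lt_add_one (by linarith [hu j])
    have hnj : (n j : ℝ) = N * (⌈1 + u j⌉₊ : ℝ) := by simp [n]
    have hNn : (N : ℝ) * (1 + u j) ≤ n j := by
      rw [hnj]
      gcongr
    have hNn' : (N : ℝ) ≤ n j := by nlinarith [hu j]
    have hn0 : (0 : ℝ) < n j := by linarith
    have hn : 0 < n j := by exact_mod_cast hn0
    have hLn : 1 - K₀ * (1 / n j) ≤ L (1 / n j) := by
      refine hL _ (by positivity) ?_
      rw [div_le_iff₀ hn0]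
      nlinarith
    have hL1 : L₀ ≤ L (1 / n j) := by
      have : K₀ * (1 / n j) ≤ 1 - L₀ := by
        rw [mul_one_div, div_le_iff₀ hn0]
        nlinarith
      linarith
    have hlog := log_one_add_sq_le (hu j)
    have hlog0 : 0 ≤ Real.log (1 + u j ^ 2) := Real.log_nonneg (by nlinarith [sq_nonneg (u j)])
    have hBj : (1 - L (1 / n j)) * (u j + ν * Real.log (1 + u j ^ 2)) ≤ B := by
      have hb : u j + ν * Real.log (1 + u j ^ 2) ≤ (1 + 2 * ν) * n j := by
        have hun : u j ≤ n j := by nlinarith [hu j]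
        calc u j + ν * Real.log (1 + u j ^ 2) ≤ u j + ν * (2 * u j) := by gcongr
          _ = (1 + 2 * ν) * u j := by ring
          _ ≤ (1 + 2 * ν) * n j := by gcongr
      calc (1 - L (1 / n j)) * (u j + ν * Real.log (1 + u j ^ 2))
          ≤ K₀ * (1 / n j) * (u j + ν * Real.log (1 + u j ^ 2)) := by
            refine mul_le_mul_of_nonneg_right (by linarith) ?_
            nlinarith [hu j]
        _ ≤ K₀ * (1 / n j) * ((1 + 2 * ν) * n j) := by gcongr
        _ = B := by
            simp only [B]
            field_simp
    have hCu : ∀ x : ℝ, (j : ℝ) ≤ x → x < j + 1 → u j ≤ Cfun (logistic x) := by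
      intro x h1 h2
      refine posLog_le_Cfun_logistic (by rw [hmj]; positivity) ?_
      rw [hmj]
      have := abs_sub_abs_le_abs_sub (j : ℝ) x
      have : |(j : ℝ) - x| ≤ 1 := abs_le.2 ⟨by linarith, by linarith⟩
      linarith
    refine (measure_block_le (by linarith) hC (by linarith) (hu j) hη hn hCu hL1 hBj).trans ?_
    refine ENNReal.ofReal_le_ofReal ?_
    have hw : (2 + u j) * Real.exp (-(u j + ν * Real.log (1 + u j ^ 2))) ≤ 12 * f (m j) :=
      two_add_mul_exp_le (by rw [hmj]; positivity)
    calc (n j : ℝ) * (M * Real.exp B * Real.exp (-(u j + ν * Real.log (1 + u j ^ 2))) *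
          Real.exp (-(L₀ * η)))
        ≤ N * (2 + u j) * (M * Real.exp B * Real.exp (-(u j + ν * Real.log (1 + u j ^ 2))) *
          Real.exp (-(L₀ * η))) := by
          rw [hnj]
          gcongr
          linarith
      _ = N * M * Real.exp B * ((2 + u j) *
          Real.exp (-(u j + ν * Real.log (1 + u j ^ 2)))) * Real.exp (-(L₀ * η)) := by ring
      _ ≤ N * M * Real.exp B * (12 * f (m j)) * Real.exp (-(L₀ * η)) := by gcongr
      _ = A * f (m j) * Real.exp (-(L₀ * η)) := by
          simp only [A]
          ring
  refine ⟨max 1 (∑' j, A * f (m j)), le_max_left _ _, fun η hη => ?_⟩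
  have hsub : {ω | ∃ t ∈ T, η < X t ω - Cfun t - ν * Dfun t} ⊆
      ⋃ j : ℤ, {ω | ∃ x, logistic x ∈ T ∧ (j : ℝ) ≤ x ∧ x < j + 1 ∧
        η < X (logistic x) ω - Cfun (logistic x) - ν * Dfun (logistic x)} := by
    rintro ω ⟨t, htT, ht⟩
    obtain ⟨x, rfl⟩ := exists_logistic_eq (hT htT)
    exact Set.mem_iUnion.2 ⟨⌊x⌋, x, htT, Int.floor_le x, Int.lt_floor_add_one x, ht⟩
  calc P _ ≤ ∑' j : ℤ, P {ω | ∃ x, logistic x ∈ T ∧ (j : ℝ) ≤ x ∧ x < j + 1 ∧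
        η < X (logistic x) ω - Cfun (logistic x) - ν * Dfun (logistic x)} :=
        (measure_mono hsub).trans (measure_iUnion_le _)
    _ ≤ ∑' j : ℤ, ENNReal.ofReal (A * f (m j) * Real.exp (-(L₀ * η))) :=
        ENNReal.tsum_le_tsum fun j => hblock j η hη
    _ = ENNReal.ofReal ((∑' j, A * f (m j)) * Real.exp (-(L₀ * η))) := by
        rw [← tsum_mul_right, ENNReal.ofReal_tsum_of_nonneg]
        · intro j
          have := hf0 (m j)
          positivity
        · exact (hf.mul_left A).mul_right _
    _ ≤ _ := by
        refine ENNReal.ofReal_le_ofReal ?_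
        gcongr
        exact le_max_right _ _
end

section
/- Let β ∈ (1/2, 1) and define r*(β) := β − 1/2 if β ∈ (1/2, 3/4] and r*(β) := (1 − √(1−β))² if β ∈ [3/4, 1). Let (ε_n) be a sequence in (0,1) with log(ε_n)/log(n) → −β, fix r with r*(β) < r < 1, set μ_n := √(2·r·log n), and let F_n(x) := (1−ε_n)·Φ(x) + ε_n·Φ(x−μ_n). Then Δ_n(F_n, Φ) → ∞ as n → ∞. -/
open MeasureTheory Filter Set ProbabilityTheory

/-- Γ(t) = C(t) + 1. -/
noncomputable def Gammafun (t : ℝ) : ℝ := Cfun t + 1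

/-- The standard normal distribution function Φ. -/
noncomputable def Phi (x : ℝ) : ℝ := (ProbabilityTheory.gaussianReal 0 1 (Set.Iic x)).toReal

/-- Δ_n(F, F_o) = sup over x with F_o(x) ∈ (0,1) of
`√n |F(x) − F_o(x)| / ( √(Γ(F_o(x)) F_o(x)(1−F_o(x))) + Γ(F_o(x))/√n )`. -/
noncomputable def Deltafun (n : ℕ) (F Fo : ℝ → ℝ) : ℝ :=
  sSup ((fun x => Real.sqrt n * |F x - Fo x| /
      (Real.sqrt (Gammafun (Fo x) * (Fo x * (1 - Fo x))) + Gammafun (Fo x) / Real.sqrt n))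
    '' {x : ℝ | Fo x ∈ Set.Ioo (0:ℝ) 1})

lemma gaussian_exp_div_three_le_pdf {x b : ℝ} (hx : 0 ≤ x) (hxb : x ≤ b) :
    Real.exp (-b ^ 2 / 2) / 3 ≤ gaussianPDFReal 0 1 x := by
  have h3 : (3 : ℝ)⁻¹ ≤ (Real.sqrt (2 * Real.pi))⁻¹ := by
    apply inv_anti₀ (Real.sqrt_pos.2 (by positivity))
    rw [Real.sqrt_le_left (by norm_num)]
    nlinarith [Real.pi_lt_four]
  have he : Real.exp (-b ^ 2 / 2) ≤ Real.exp (-x ^ 2 / 2) := by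
    apply Real.exp_le_exp.2
    nlinarith
  simp only [gaussianPDFReal, NNReal.coe_one, mul_one, sub_zero]
  rw [div_eq_inv_mul]
  gcongr

lemma Phi_sub_Phi {a b : ℝ} (hab : a ≤ b) :
    Phi b - Phi a = (gaussianReal 0 1).real (Ioc a b) := by
  have h : (gaussianReal 0 1).real (Iic b \ Iic a)
      = (gaussianReal 0 1).real (Iic b) - (gaussianReal 0 1).real (Iic a) :=
    measureReal_sdiff (Iic_subset_Iic.2 hab) measurableSet_Iic
  have hset : Iic b \ Iic a = Ioc a b := by
    ext z
    simp [and_comm]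
  rw [hset] at h
  exact h.symm

lemma one_sub_Phi (x : ℝ) : 1 - Phi x = (gaussianReal 0 1).real (Ioi x) := by
  rw [← compl_Iic, probReal_compl_eq_one_sub measurableSet_Iic]
  rfl

lemma Phi_mono : Monotone Phi := fun _ _ h => measureReal_mono (Iic_subset_Iic.2 h)

lemma Phi_nonneg (x : ℝ) : 0 ≤ Phi x := ENNReal.toReal_nonneg

lemma Phi_le_one (x : ℝ) : Phi x ≤ 1 := measureReal_le_one

lemma exp_div_three_le_Phi_sub {y : ℝ} (hy : 0 ≤ y) :
    Real.exp (-(y + 1) ^ 2 / 2) / 3 ≤ Phi (y + 1) - Phi y := by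
  rw [Phi_sub_Phi (by linarith), Measure.real, gaussianReal_apply 0 one_ne_zero]
  have hle : ENNReal.ofReal (Real.exp (-(y + 1) ^ 2 / 2) / 3)
      ≤ ∫⁻ x in Ioc y (y + 1), gaussianPDF 0 1 x := by
    calc ENNReal.ofReal (Real.exp (-(y + 1) ^ 2 / 2) / 3)
        = ∫⁻ _ in Ioc y (y + 1), ENNReal.ofReal (Real.exp (-(y + 1) ^ 2 / 2) / 3) := by
          simp
      _ ≤ _ := setLIntegral_mono (measurable_gaussianPDF 0 1) fun x hx =>
          ENNReal.ofReal_le_ofReal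
            (gaussian_exp_div_three_le_pdf (hy.trans hx.1.le) hx.2)
  have hfin : ∫⁻ x in Ioc y (y + 1), gaussianPDF 0 1 x ≠ ⊤ := by
    rw [← gaussianReal_apply 0 one_ne_zero]
    exact measure_ne_top _ _
  exact (ENNReal.ofReal_le_iff_le_toReal hfin).1 hle

lemma one_sub_Phi_le {x : ℝ} (hx : 0 ≤ x) : 1 - Phi x ≤ Real.exp (-x ^ 2 / 2) := by
  have hint : Integrable (fun z => Real.exp (x * id z)) (gaussianReal 0 1) :=
    integrable_exp_mul_gaussianReal x
  have h := measure_ge_le_exp_mul_mgf (μ := gaussianReal 0 1) (X := id) x hx hint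
  rw [mgf_id_gaussianReal, ← Real.exp_add] at h
  rw [one_sub_Phi]
  refine (measureReal_mono fun z hz => ?_).trans (h.trans (Real.exp_le_exp.2 ?_))
  · exact (mem_Ioi.1 hz).le
  · simp only [NNReal.coe_one]
    nlinarith

lemma one_le_log_exp_one_div {t : ℝ} (ht : t ∈ Ioo (0 : ℝ) 1) :
    1 ≤ Real.log (Real.exp 1 / (4 * t * (1 - t))) := by
  obtain ⟨h0, h1⟩ := ht
  have hpos : 0 < 4 * t * (1 - t) := mul_pos (by linarith) (by linarith)
  rw [Real.le_log_iff_exp_le (by positivity), le_div_iff₀ hpos]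
  have : 4 * t * (1 - t) ≤ 1 := by nlinarith [sq_nonneg (2 * t - 1)]
  nlinarith [Real.exp_pos 1]

lemma one_le_Gammafun {t : ℝ} (ht : t ∈ Ioo (0 : ℝ) 1) : 1 ≤ Gammafun t := by
  have := Real.log_nonneg (one_le_log_exp_one_div ht)
  simp only [Gammafun, Cfun]
  linarith

lemma Gammafun_le {t : ℝ} (ht : t ∈ Ioo (1 / 4 : ℝ) 1) :
    Gammafun t ≤ 1 - Real.log (1 - t) := by
  obtain ⟨h0, h1⟩ := ht
  have hone := one_le_log_exp_one_div (t := t) ⟨by linarith, h1⟩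
  have hlog := Real.log_le_sub_one_of_pos (zero_lt_one.trans_le hone)
  have hpos : 0 < 4 * t * (1 - t) := mul_pos (by linarith) (by linarith)
  have hmono : Real.log (1 - t) ≤ Real.log (4 * t * (1 - t)) :=
    Real.log_le_log (by linarith) (by nlinarith)
  simp only [Gammafun, Cfun]
  rw [Real.log_div (Real.exp_pos 1).ne' hpos.ne', Real.log_exp] at *
  linarith

lemma bddAbove_Deltafun {n : ℕ} (hn : n ≠ 0) {F Fo : ℝ → ℝ} (hF : ∀ x, |F x - Fo x| ≤ 1) :
    BddAbove ((fun x => Real.sqrt n * |F x - Fo x| /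
      (Real.sqrt (Gammafun (Fo x) * (Fo x * (1 - Fo x))) + Gammafun (Fo x) / Real.sqrt n))
      '' {x : ℝ | Fo x ∈ Set.Ioo (0:ℝ) 1}) := by
  refine ⟨n, ?_⟩
  rintro _ ⟨x, hx, rfl⟩
  have hs : 0 < Real.sqrt n := Real.sqrt_pos.2 (by positivity)
  have hG : 1 ≤ Gammafun (Fo x) := one_le_Gammafun hx
  have hD : 1 / Real.sqrt n ≤ Real.sqrt (Gammafun (Fo x) * (Fo x * (1 - Fo x)))
      + Gammafun (Fo x) / Real.sqrt n := by
    have h1 : 1 / Real.sqrt n ≤ Gammafun (Fo x) / Real.sqrt n := by gcongr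
    linarith [Real.sqrt_nonneg (Gammafun (Fo x) * (Fo x * (1 - Fo x)))]
  calc _ ≤ Real.sqrt n * 1 / (1 / Real.sqrt n) := by
        dsimp only
        gcongr
        exact hF x
    _ = n := by
        rw [mul_one, div_div_eq_mul_div, div_one, Real.mul_self_sqrt (Nat.cast_nonneg n)]

lemma abs_mixture_sub_le_one {e : ℝ} (he : e ∈ Ioo (0 : ℝ) 1) (m x : ℝ) :
    |((1 - e) * Phi x + e * Phi (x - m)) - Phi x| ≤ 1 := by
  have h1 := Phi_nonneg x
  have h2 := Phi_le_one x
  have h3 := Phi_nonneg (x - m)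
  have h4 := Phi_le_one (x - m)
  have heq : ((1 - e) * Phi x + e * Phi (x - m)) - Phi x = e * (Phi (x - m) - Phi x) := by ring
  rw [heq, abs_mul, abs_of_pos he.1]
  have : |Phi (x - m) - Phi x| ≤ 1 := abs_le.2 ⟨by linarith, by linarith⟩
  exact mul_le_one₀ he.2.le (abs_nonneg _) this

/-- The bound is obtained by evaluating the supremum at the single point `x = y + m`. -/
lemma le_Deltafun_mixture {n : ℕ} (hn : n ≠ 0) {e m y q : ℝ} (he : e ∈ Ioo (0 : ℝ) 1)
    (hy : 0 ≤ y) (hm : 1 ≤ m) (hx : 2 ≤ y + m) (hq1 : q ≤ 1)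
    (hq : (y + m) ^ 2 = 2 * q * Real.log n) :
    Real.exp (Real.log n / 2 + Real.log e - (y + 1) ^ 2 / 2 + q * Real.log n / 2)
        / (6 * (4 + (y + m) ^ 2))
      ≤ Deltafun n (fun x => (1 - e) * Phi x + e * Phi (x - m)) Phi := by
  set x := y + m with hxdef
  set L := Real.log n with hL
  have hn0 : (0 : ℝ) < n := by positivity
  have hL0 : 0 ≤ L := Real.log_natCast_nonneg n
  have hsqrt : Real.sqrt n = Real.exp (L / 2) := by
    rw [← Real.exp_log hn0, ← Real.exp_half]
  have hup : 1 - Phi x ≤ Real.exp (-(q * L)) := by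
    have h := one_sub_Phi_le (x := x) (by linarith)
    rwa [hq, show -(2 * q * L) / 2 = -(q * L) by ring] at h
  have hlow : Real.exp (-(x + 1) ^ 2 / 2) / 3 ≤ 1 - Phi x :=
    (exp_div_three_le_Phi_sub (by linarith)).trans (by linarith [Phi_le_one (x + 1)])
  have hhalf : Real.exp (-(q * L)) ≤ 1 / 2 := by
    have h1 : q * L ≥ 1 := by nlinarith
    have h2 : Real.exp (-(q * L)) ≤ Real.exp (-1) := Real.exp_le_exp.2 (by linarith)
    have h3 := Real.exp_neg_one_lt_half
    linarith
  have hpos : 0 < 1 - Phi x := lt_of_lt_of_le (by positivity) hlow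
  have ht : Phi x ∈ Ioo (1 / 4 : ℝ) 1 := ⟨by linarith, by linarith⟩
  have ht0 : Phi x ∈ Ioo (0 : ℝ) 1 := ⟨by linarith, by linarith⟩
  have hG1 := one_le_Gammafun ht0
  have hG : Gammafun (Phi x) ≤ 4 + x ^ 2 := by
    have h1 := Gammafun_le ht
    have h2 := Real.log_le_log (by positivity) hlow
    rw [Real.log_div (Real.exp_pos _).ne' (by norm_num), Real.log_exp] at h2
    have h3 := Real.log_le_sub_one_of_pos (show (0 : ℝ) < 3 by norm_num)
    nlinarith [sq_nonneg (x - 1)]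
  have hnum : e * (Real.exp (-(y + 1) ^ 2 / 2) / 3)
      ≤ |((1 - e) * Phi x + e * Phi (x - m)) - Phi x| := by
    have heq : ((1 - e) * Phi x + e * Phi (x - m)) - Phi x = -(e * (Phi x - Phi y)) := by
      rw [show x - m = y by rw [hxdef]; ring]
      ring
    have h1 := exp_div_three_le_Phi_sub hy
    have h2 : Phi (y + 1) ≤ Phi x := Phi_mono (by linarith)
    rw [heq, abs_neg]
    refine le_trans ?_ (le_abs_self _)
    exact mul_le_mul_of_nonneg_left (by linarith) he.1.le
  have hden : Real.sqrt (Gammafun (Phi x) * (Phi x * (1 - Phi x)))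
      + Gammafun (Phi x) / Real.sqrt n ≤ 2 * (4 + x ^ 2) * Real.exp (-(q * L / 2)) := by
    have h1 : Real.sqrt (Gammafun (Phi x) * (Phi x * (1 - Phi x)))
        ≤ Gammafun (Phi x) * Real.exp (-(q * L / 2)) := by
      apply Real.sqrt_le_iff.2 ⟨by positivity, ?_⟩
      rw [mul_pow, ← Real.exp_nat_mul]
      have hh : ((2 : ℕ) : ℝ) * (-(q * L / 2)) = -(q * L) := by push_cast; ring
      rw [hh]
      have h2 : Phi x * (1 - Phi x) ≤ Real.exp (-(q * L)) := by nlinarith [ht0.2, ht0.1]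
      have h3 : Gammafun (Phi x) ≤ Gammafun (Phi x) ^ 2 := by nlinarith
      exact mul_le_mul h3 h2 (mul_nonneg ht0.1.le hpos.le) (by positivity)
    have h2 : Gammafun (Phi x) / Real.sqrt n ≤ Gammafun (Phi x) * Real.exp (-(q * L / 2)) := by
      rw [hsqrt, div_eq_mul_inv, ← Real.exp_neg]
      gcongr
      nlinarith
    have h3 : Gammafun (Phi x) * Real.exp (-(q * L / 2))
        ≤ (4 + x ^ 2) * Real.exp (-(q * L / 2)) := by gcongr
    linarith
  have hdenpos : 0 < Real.sqrt (Gammafun (Phi x) * (Phi x * (1 - Phi x)))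
      + Gammafun (Phi x) / Real.sqrt n := by
    have : 0 < Real.sqrt n := by rw [hsqrt]; positivity
    positivity
  refine le_trans ?_ (le_csSup (bddAbove_Deltafun hn fun x => abs_mixture_sub_le_one he m x)
    ⟨x, ht0, rfl⟩)
  calc _ = Real.sqrt n * (e * (Real.exp (-(y + 1) ^ 2 / 2) / 3))
        / (2 * (4 + x ^ 2) * Real.exp (-(q * L / 2))) := by
        have hexp : Real.exp (L / 2 + Real.log e - (y + 1) ^ 2 / 2 + q * L / 2)
            = Real.exp (L / 2) * e * Real.exp (-(y + 1) ^ 2 / 2) / Real.exp (-(q * L / 2)) := by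
          rw [← Real.exp_log he.1, ← Real.exp_add, ← Real.exp_add, ← Real.exp_sub, Real.log_exp]
          congr 1
          ring
        rw [hexp, hsqrt]
        field_simp
        ring
    _ ≤ _ := by
        dsimp only
        gcongr

/-- The detection exponent at the level `q = min (4 r) 1` is positive above the boundary. -/
lemma exists_level_of_boundary_lt {β r : ℝ} (hβ : β ∈ Ioo (1/2 : ℝ) 1)
    (hr1 : (if β ≤ 3/4 then β - 1/2 else (1 - Real.sqrt (1 - β)) ^ 2) < r) (hr2 : r < 1) :
    0 < r ∧ ∃ q, r ≤ q ∧ q ≤ 1 ∧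
      0 < 1 / 2 - β - (Real.sqrt q - Real.sqrt r) ^ 2 + q / 2 := by
  obtain ⟨hβ1, hβ2⟩ := hβ
  have hr0 : 0 < r := by
    split_ifs at hr1 with h
    · linarith
    · exact lt_of_le_of_lt (sq_nonneg _) hr1
  refine ⟨hr0, ?_⟩
  set c := Real.sqrt (1 - β) with hc
  have hc0 : 0 ≤ c := Real.sqrt_nonneg _
  have hc2 : c ^ 2 = 1 - β := Real.sq_sqrt (by linarith)
  set s := Real.sqrt r with hs
  have hs0 : 0 ≤ s := Real.sqrt_nonneg _
  have hs2 : s ^ 2 = r := Real.sq_sqrt hr0.le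
  by_cases h4 : r < 1 / 4
  · refine ⟨4 * r, by linarith, by linarith, ?_⟩
    have h4r : Real.sqrt (4 * r) = 2 * s := by
      rw [← hs2, show 4 * s ^ 2 = (2 * s) ^ 2 by ring, Real.sqrt_sq (by positivity)]
    have hb : β - 1 / 2 < r := by
      split_ifs at hr1 with h
      · exact hr1
      · have : c < 1 / 2 := by nlinarith
        nlinarith
    rw [h4r]
    nlinarith
  · refine ⟨1, hr2.le, le_rfl, ?_⟩
    have hs1 : s < 1 := by nlinarith
    have hs12 : 1 / 2 ≤ s := by nlinarith
    have key : 1 - s < c := by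
      split_ifs at hr1 with h
      · have hc12 : 1 / 2 ≤ c := by nlinarith
        by_contra hcon
        have : c = 1 / 2 := by linarith
        have : s = 1 / 2 := by linarith
        nlinarith
      · have hc1 : c < 1 / 2 := by nlinarith
        by_contra hcon
        nlinarith
    rw [Real.sqrt_one]
    nlinarith

lemma tendsto_exp_mul_div_affine_atTop {δ : ℝ} (hδ : 0 < δ) :
    Tendsto (fun L : ℝ => Real.exp (δ * L) / (6 * (4 + 2 * L))) atTop atTop := by
  have h1 : Tendsto (fun L : ℝ => Real.exp (δ * L) / (δ * L) ^ 1) atTop atTop :=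
    (Real.tendsto_exp_div_pow_atTop 1).comp (tendsto_id.const_mul_atTop hδ)
  refine tendsto_atTop_mono' _ ?_ (h1.const_mul_atTop (show 0 < δ / 36 by positivity))
  filter_upwards [eventually_ge_atTop (1 : ℝ)] with L hL
  have : δ / 36 * (Real.exp (δ * L) / (δ * L) ^ 1) = Real.exp (δ * L) / (36 * L) := by
    field_simp
  rw [this]
  exact div_le_div_of_nonneg_left (Real.exp_pos _).le (by linarith) (by linarith)

/-- Lemma 4.2(a) of Dümbgen–Wellner: let `β ∈ (1/2, 1)`,
`r*(β) = β − 1/2` for `β ∈ (1/2, 3/4]` and `r*(β) = (1 − √(1−β))²` for `β ∈ [3/4, 1)`.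
If `ε_n ∈ (0,1)` with `log(ε_n)/log(n) → −β`, `r*(β) < r < 1`, `μ_n = √(2 r log n)` and
`F_n = (1−ε_n) Φ + ε_n Φ(· − μ_n)`, then `Δ_n(F_n, Φ) → ∞`. -/
theorem stmt9 (β : ℝ) (hβ : β ∈ Set.Ioo (1/2 : ℝ) 1) (r : ℝ)
    (hr1 : (if β ≤ 3/4 then β - 1/2 else (1 - Real.sqrt (1 - β)) ^ 2) < r) (hr2 : r < 1)
    (ε : ℕ → ℝ) (hε : ∀ n, ε n ∈ Set.Ioo (0:ℝ) 1)
    (hεlim : Filter.Tendsto (fun n : ℕ => Real.log (ε n) / Real.log n)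
      Filter.atTop (nhds (-β))) :
    Filter.Tendsto (fun n : ℕ => Deltafun n
        (fun x => (1 - ε n) * Phi x + ε n * Phi (x - Real.sqrt (2 * r * Real.log n))) Phi)
      Filter.atTop Filter.atTop := by
  obtain ⟨hr0, q, hrq, hq1, hδ⟩ := exists_level_of_boundary_lt hβ hr1 hr2
  have hq0 : 0 < q := hr0.trans_le hrq
  set d := Real.sqrt q - Real.sqrt r with hd
  have hd0 : 0 ≤ d := sub_nonneg.2 (Real.sqrt_le_sqrt hrq)
  set δ := 1 / 2 - β - d ^ 2 + q / 2 with hδdef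
  have hL : Tendsto (fun n : ℕ => Real.log n) atTop atTop :=
    Real.tendsto_log_atTop.comp tendsto_natCast_atTop_atTop
  have hW : Tendsto (fun n : ℕ => Real.sqrt (2 * Real.log n)) atTop atTop :=
    Real.tendsto_sqrt_atTop.comp (hL.const_mul_atTop two_pos)
  have hexpo : Tendsto (fun n : ℕ => 1 / 2 + Real.log (ε n) / Real.log n
      - (d + (Real.sqrt (2 * Real.log n))⁻¹) ^ 2 + q / 2) atTop (nhds δ) := by
    have h := ((hεlim.const_add (1 / 2)).sub
      ((hW.inv_tendsto_atTop.const_add d).pow 2)).add_const (q / 2)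
    have hlim : 1 / 2 + -β - (d + 0) ^ 2 + q / 2 = δ := by
      rw [hδdef]
      ring
    rwa [hlim] at h
  have hsr : 0 < Real.sqrt r := Real.sqrt_pos.2 hr0
  have hsq : 0 < Real.sqrt q := Real.sqrt_pos.2 hq0
  refine tendsto_atTop_mono' _ ?_
    ((tendsto_exp_mul_div_affine_atTop (half_pos hδ)).comp hL)
  filter_upwards [hexpo.eventually_const_lt (half_lt_self hδ), hL.eventually_ge_atTop 1,
    (hW.const_mul_atTop hsr).eventually_ge_atTop 1,
    (hW.const_mul_atTop hsq).eventually_ge_atTop 2, eventually_ne_atTop 0]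
    with n h1 h2 h3 h4 hn
  set L := Real.log n with hLdef
  set w := Real.sqrt (2 * L) with hw
  have hw2 : w ^ 2 = 2 * L := Real.sq_sqrt (by linarith)
  have hw0 : 0 < w := Real.sqrt_pos.2 (by linarith)
  have hm : Real.sqrt (2 * r * L) = Real.sqrt r * w := by
    rw [hw, ← Real.sqrt_mul hr0.le]
    congr 1
    ring
  have hsum : d * w + Real.sqrt r * w = Real.sqrt q * w := by rw [hd]; ring
  have hsum2 : (d * w + Real.sqrt r * w) ^ 2 = 2 * q * L := by
    rw [hsum, mul_pow, Real.sq_sqrt hq0.le, hw2]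
    ring
  rw [hm]
  refine le_trans ?_ (le_Deltafun_mixture hn (hε n) (mul_nonneg hd0 hw0.le) h3
    (by rw [hsum]; exact h4) hq1 hsum2)
  rw [hsum2]
  have hE : L / 2 + Real.log (ε n) - (d * w + 1) ^ 2 / 2 + q * L / 2
      = (1 / 2 + Real.log (ε n) / L - (d + w⁻¹) ^ 2 + q / 2) * L := by
    have hsq : (d * w + 1) ^ 2 = (d + w⁻¹) ^ 2 * (2 * L) := by
      rw [← hw2]
      field_simp
    have hlog : Real.log (ε n) = Real.log (ε n) / L * L := by field_simp
    rw [hsq]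
    linear_combination hlog
  rw [← hLdef, hE]
  simp only [Function.comp_apply]
  gcongr
  nlinarith
end

section
/- Let (γ̃_n)_{n≥16} be a sequence of positive reals with n·γ̃_n / log log n → 1 as n → ∞. Then limsup_{n→∞} max_{0 ≤ j < n} ( b((j+1)/(n+1), γ̃_n) − j/n ) / ( b(j/n, γ̃_n) − j/n ) ≤ 1. -/
open MeasureTheory Filter Set

/-- K(s,t) = s log(s/t) + (1−s) log((1−s)/(1−t)), with the convention 0·log 0 = 0. -/
noncomputable def Kfun (s t : ℝ) : ℝ :=
  s * Real.log (s / t) + (1 - s) * Real.log ((1 - s) / (1 - t))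

/-- Moving `s` towards `1` by a fraction `l` decreases `Kfun · t` only slightly. -/
theorem Kfun_lineMap_one_ge {s t l : ℝ} (hs0 : 0 ≤ s) (hs1 : s < 1) (ht0 : 0 < t) (ht1 : t < 1)
    (hl0 : 0 < l) (hl1 : l < 1) :
    (1 - l) * Kfun s t - l * Real.log (t / (s + l * (1 - s))) - l
      ≤ Kfun (s + l * (1 - s)) t := by
  have hs' : 0 < s + l * (1 - s) := by nlinarith
  have h1 : 1 - (s + l * (1 - s)) = (1 - l) * (1 - s) := by ring
  have hlog : -l ≤ (1 - l) * Real.log (1 - l) := by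
    have h := Real.one_sub_inv_le_log_of_pos (sub_pos.2 hl1)
    have h2 := mul_le_mul_of_nonneg_left h (sub_pos.2 hl1).le
    rw [mul_sub, mul_inv_cancel₀ (sub_pos.2 hl1).ne'] at h2
    linarith
  have hlog' : -l ≤ (1 - s) * ((1 - l) * Real.log (1 - l)) := by nlinarith
  have hlogs : s * Real.log (s / t) ≤ s * (Real.log (s + l * (1 - s)) - Real.log t) := by
    rcases hs0.eq_or_lt with rfl | hs
    · simp
    · rw [Real.log_div hs.ne' ht0.ne']
      have := Real.log_le_log hs (show s ≤ s + l * (1 - s) by nlinarith)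
      gcongr
  unfold Kfun
  rw [h1, Real.log_div ht0.ne' hs'.ne', Real.log_div hs'.ne' ht0.ne',
    Real.log_div (mul_pos (sub_pos.2 hl1) (sub_pos.2 hs1)).ne' (sub_pos.2 ht1).ne',
    Real.log_mul (sub_pos.2 hl1).ne' (sub_pos.2 hs1).ne',
    Real.log_div (sub_pos.2 hs1).ne' (sub_pos.2 ht1).ne']
  nlinarith [mul_le_mul_of_nonneg_left hlogs (sub_pos.2 hl1).le]

/-- Chord inequality for `Kfun s`, which is convex and vanishes at `s`. -/
theorem sub_mul_Kfun_le {s t u : ℝ} (hs0 : 0 ≤ s) (hst : s < t) (htu : t < u) (hu : u < 1) :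
    (u - s) * Kfun s t ≤ (t - s) * Kfun s u := by
  have concave : ∀ x y z : ℝ, 0 < x → 0 < z → ∀ a c : ℝ, 0 ≤ a → 0 ≤ c → a + c = 1 →
      y = a * x + c * z → a * Real.log x + c * Real.log z ≤ Real.log y := by
    intro x y z hx hz a c ha hc hac hy
    have := strictConcaveOn_log_Ioi.concaveOn.2 (Set.mem_Ioi.2 hx) (Set.mem_Ioi.2 hz) ha hc hac
    simpa [hy] using this
  have hus : 0 < u - s := by linarith
  have ha : 0 ≤ (u - t) / (u - s) := div_nonneg (by linarith) hus.le
  have hc : 0 ≤ (t - s) / (u - s) := div_nonneg (by linarith) hus.le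
  have hac : (u - t) / (u - s) + (t - s) / (u - s) = 1 := by field_simp; ring
  have h2 := concave (1 - s) (1 - t) (1 - u) (by linarith) (by linarith) _ _ ha hc hac
    (by field_simp; ring)
  have clear_denom : ∀ p q r : ℝ, (u - t) / (u - s) * p + (t - s) / (u - s) * q ≤ r →
      (u - t) * p + (t - s) * q ≤ (u - s) * r := by
    intro p q r h
    have := mul_le_mul_of_nonneg_left h hus.le
    field_simp at this
    linarith
  have h2' := mul_le_mul_of_nonneg_left (clear_denom _ _ _ h2) (show 0 ≤ 1 - s by linarith)
  have hs1 : (1 - s) ≠ 0 := by linarith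
  have ht1 : (1 - t) ≠ 0 := by linarith
  have hu1 : (1 - u) ≠ 0 := by linarith
  unfold Kfun
  rw [Real.log_div hs1 ht1, Real.log_div hs1 hu1]
  rcases hs0.eq_or_lt with rfl | hs
  · simp only [zero_mul, zero_add]
    linarith
  · have h1 := concave s t u hs (by linarith) _ _ ha hc hac (by field_simp; ring)
    have h1' := mul_le_mul_of_nonneg_left (clear_denom _ _ _ h1) hs0
    rw [Real.log_div hs.ne' (by linarith), Real.log_div hs.ne' (by linarith)]
    linarith

theorem le_four_mul_add_Kfun {s t : ℝ} (hs0 : 0 < s) (hst : s < t) (ht1 : t < 1)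
    (hK : 0 ≤ Kfun s t) : t ≤ 4 * (s + Kfun s t) := by
  rcases le_or_gt t (4 * s) with h | h
  · linarith
  have ht0 : 0 < t := hs0.trans hst
  have hs1 : 0 < 1 - s := by linarith
  have h1 := Real.one_sub_inv_le_log_of_pos (div_pos hs1 (sub_pos.2 ht1))
  have h1' := mul_le_mul_of_nonneg_left h1 hs1.le
  have e1 : (1 - s) * (1 - ((1 - s) / (1 - t))⁻¹) = t - s := by
    rw [inv_div]; field_simp; ring
  have h2 := Real.log_le_sub_one_of_pos (show 0 < t / s / 2 by positivity)
  rw [Real.log_div (by positivity) two_ne_zero] at h2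
  have h2' := mul_le_mul_of_nonneg_left h2 hs0.le
  have e2 : s * (t / s / 2 - 1) = t / 2 - s := by field_simp
  have e3 : Real.log (s / t) = -Real.log (t / s) := by rw [← Real.log_inv, inv_div]
  have hlog2 : Real.log 2 < 1 := by linarith [Real.log_two_lt_d9]
  have h3 : s * Real.log 2 ≤ s * 1 := by gcongr
  unfold Kfun at *
  rw [e3] at *
  linarith

theorem eventually_log_add_one_lt_mul {c : ℝ} (hc : 0 < c) :
    ∀ᶠ x : ℝ in atTop, Real.log (20 * x) + 1 < c * x := by
  have h := Real.isLittleO_log_id_atTop.bound (half_pos hc)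
  filter_upwards [h, eventually_gt_atTop 0,
    eventually_gt_atTop ((Real.log 20 + 1) / (c / 2))] with x hx hx0 hx1
  rw [div_lt_iff₀ (by positivity)] at hx1
  rw [Real.log_mul (by norm_num) hx0.ne']
  have h2 := (le_abs_self (Real.log x)).trans hx
  simp only [id, Real.norm_eq_abs, abs_of_pos hx0] at h2
  linarith

/-- Key step in Theorem 5.1 of Dümbgen–Wellner (asymptotic efficiency): let `b(s,γ)` be
the unique solution `b ∈ (s,1)` of `K(s,b) = γ` for `s ∈ (0,1)`, `γ > 0`, with
`b(0,γ) = 1 − e^{−γ}`.  If `(γ̃_n)` are positive reals with `n γ̃_n / log log n → 1`, then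
`limsup_{n→∞} max_{0 ≤ j < n} ( b((j+1)/(n+1), γ̃_n) − j/n ) / ( b(j/n, γ̃_n) − j/n ) ≤ 1`,
expressed in the equivalent form: for every `ε > 0`, eventually in `n`, all the ratios
are at most `1 + ε`. -/
theorem stmt11
    (b : ℝ → ℝ → ℝ)
    (hb0 : ∀ γ : ℝ, 0 < γ → b 0 γ = 1 - Real.exp (-γ))
    (hb : ∀ s : ℝ, s ∈ Set.Ioo (0:ℝ) 1 → ∀ γ : ℝ, 0 < γ →
      b s γ ∈ Set.Ioo s 1 ∧ Kfun s (b s γ) = γ)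
    (γ : ℕ → ℝ) (hγ : ∀ n : ℕ, 16 ≤ n → 0 < γ n)
    (hγlim : Filter.Tendsto (fun n : ℕ => (n : ℝ) * γ n / Real.log (Real.log n))
      Filter.atTop (nhds 1)) :
    ∀ ε : ℝ, 0 < ε → ∀ᶠ n : ℕ in Filter.atTop, ∀ j : ℕ, j < n →
      (b (((j : ℝ) + 1) / ((n : ℝ) + 1)) (γ n) - (j : ℝ) / n)
        / (b ((j : ℝ) / n) (γ n) - (j : ℝ) / n) ≤ 1 + ε := by
  intro ε hε
  have hL : Tendsto (fun n : ℕ => Real.log (Real.log n)) atTop atTop :=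
    Real.tendsto_log_atTop.comp (Real.tendsto_log_atTop.comp tendsto_natCast_atTop_atTop)
  filter_upwards [eventually_ge_atTop 16,
    hγlim.eventually (lt_mem_nhds (show (1 / 2 : ℝ) < 1 by norm_num)),
    hγlim.eventually (gt_mem_nhds (show (1 : ℝ) < 2 by norm_num)),
    hL.eventually (eventually_log_add_one_lt_mul (show 0 < ε / 4 by positivity)),
    hL.eventually (eventually_ge_atTop 1),
    tendsto_natCast_atTop_atTop.eventually (eventually_ge_atTop (2 / ε))]
    with n hn hlo hhi hlog hL1 hnε j hj
  set L := Real.log (Real.log n)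
  have hL0 : 0 < L := by linarith
  rw [lt_div_iff₀ hL0] at hlo
  rw [div_lt_iff₀ hL0] at hhi
  rw [div_le_iff₀ hε] at hnε
  have hg := hγ n hn
  set g := γ n
  have hn0 : (0 : ℝ) < n := by exact_mod_cast (show 0 < n by omega)
  have hn1 : (1 : ℝ) ≤ n := by exact_mod_cast (show 1 ≤ n by omega)
  have hjn : (j : ℝ) < n := by exact_mod_cast hj
  have hj0 : (0 : ℝ) ≤ j := j.cast_nonneg
  have hs0 : (0 : ℝ) ≤ j / n := by positivity
  have hs1 : (j : ℝ) / n < 1 := by rw [div_lt_one hn0]; exact hjn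
  have hl0 : (0 : ℝ) < 1 / (n + 1) := by positivity
  have hl1 : (1 : ℝ) / (n + 1) < 1 := by rw [div_lt_one (by positivity)]; linarith
  have hs' : ((j : ℝ) + 1) / (n + 1) = j / n + 1 / (n + 1) * (1 - j / n) := by
    field_simp; ring
  have hs'0 : (0 : ℝ) < (j + 1) / (n + 1) := by positivity
  have hs'1 : ((j : ℝ) + 1) / (n + 1) < 1 := by rw [div_lt_one (by positivity)]; linarith
  have hss' : (j : ℝ) / n < (j + 1) / (n + 1) := by rw [hs']; nlinarith
  have hs'n : 1 ≤ ((j : ℝ) + 1) / (n + 1) * (2 * n) := by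
    rw [div_mul_eq_mul_div, le_div_iff₀ (by positivity)]
    nlinarith
  have hbs : b (j / n) g ∈ Set.Ioo ((j : ℝ) / n) 1 ∧ Kfun (j / n) (b (j / n) g) = g := by
    rcases hs0.eq_or_lt with h | h
    · rw [← h, hb0 g hg]
      have h1 : Real.exp (-g) < 1 := by rw [Real.exp_lt_one_iff]; linarith
      refine ⟨⟨by linarith, by linarith [Real.exp_pos (-g)]⟩, ?_⟩
      simp [Kfun]
    · exact hb _ ⟨h, hs1⟩ g hg
  obtain ⟨⟨ht, -⟩, hKt⟩ := hbs
  obtain ⟨⟨hu, hu1⟩, hKu⟩ := hb _ ⟨hs'0, hs'1⟩ g hg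
  have hu4 := le_four_mul_add_Kfun hs'0 hu hu1 (by rw [hKu]; exact hg.le)
  have hlow := Kfun_lineMap_one_ge hs0 hs1 (hs'0.trans hu) hu1 hl0 hl1
  rw [← hs', hKu] at hlow
  rw [hKu] at hu4
  set s := (j : ℝ) / n
  set s' := ((j : ℝ) + 1) / (n + 1)
  set t := b s g
  set u := b s' g
  rw [div_le_iff₀ (sub_pos.2 ht)]
  by_contra! hcon
  have htu : t < u := by nlinarith
  have hchord := sub_mul_Kfun_le hs0 ht htu hu1
  rw [hKt] at hchord
  have hK : (1 + ε) * g ≤ Kfun s u := by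
    refine le_of_mul_le_mul_left ?_ (sub_pos.2 ht)
    nlinarith
  have hgs : g ≤ 4 * L * s' := by
    refine le_of_mul_le_mul_left ?_ hn0
    nlinarith
  have hus : u / s' ≤ 20 * L := by
    rw [div_le_iff₀ hs'0]
    nlinarith
  have hlogu := Real.log_le_log (div_pos (hs'0.trans hu) hs'0) hus
  have hmain : n * ((1 + ε) * g) - Real.log (u / s') - 1 ≤ (n + 1) * g := by
    have h1 := mul_le_mul_of_nonneg_left hlow (show (0 : ℝ) ≤ n + 1 by positivity)
    have h2 : ((n : ℝ) + 1) * ((1 - 1 / (n + 1)) * Kfun s u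
        - 1 / (n + 1) * Real.log (u / s') - 1 / (n + 1))
        = n * Kfun s u - Real.log (u / s') - 1 := by
      field_simp; ring
    rw [h2] at h1
    linarith [mul_le_mul_of_nonneg_left hK hn0.le]
  nlinarith [mul_le_mul_of_nonneg_left hnε hg.le, mul_lt_mul_of_pos_left hlo hε]
end

section
/- (i) If (γ_n)_{n≥16} is a sequence of positive reals with n·γ_n / log log n → 1, then max_{0 ≤ j < n} ( b(j/n, γ_n) − j/n ) / √( (log log n)/(2n) ) → 1 as n → ∞. (ii) Fix ν > 1 and a bounded sequence (κ_n) of nonnegative reals, and set γ_n(t) := ( C(t) + ν·D(t) + κ_n )/(n+1) for t ∈ (0,1). Then max_{0 ≤ j < n} ( b( (j+1)/(n+1), γ_n((j+1)/(n+1)) ) − j/n ) = O(n^{−1/2}) as n → ∞. -/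
open MeasureTheory Filter Set

theorem hasDerivAt_Kfun {s x : ℝ} (hs : s ∈ Ioo (0 : ℝ) 1) (hx : x ∈ Ioo (0 : ℝ) 1) :
    HasDerivAt (Kfun s) ((x - s) / (x * (1 - x))) x := by
  obtain ⟨hs0, hs1⟩ := hs
  obtain ⟨hx0, hx1⟩ := hx
  have h1x : 0 < 1 - x := by linarith
  have h1s : 0 < 1 - s := by linarith
  have h₁ := (((hasDerivAt_const x s).div (hasDerivAt_id x) hx0.ne').log
    (div_pos hs0 hx0).ne').const_mul s
  have h₂ := (((hasDerivAt_const x (1 - s)).div ((hasDerivAt_id x).const_sub 1) h1x.ne').log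
    (div_pos h1s h1x).ne').const_mul (1 - s)
  refine (h₁.add h₂).congr_deriv ?_
  simp only [id, Pi.div_apply]
  field_simp
  ring

theorem Kfun_self {s : ℝ} (hs : s ∈ Ioo (0 : ℝ) 1) : Kfun s s = 0 := by
  have h : 1 - s ≠ 0 := by linarith [hs.2]
  simp [Kfun, div_self hs.1.ne', div_self h]

theorem hasDerivAt_Kfun_sub_sq {s x : ℝ} (M : ℝ) (hs : s ∈ Ioo (0 : ℝ) 1)
    (hx : x ∈ Ioo (0 : ℝ) 1) :
    HasDerivAt (fun y => Kfun s y - (y - s) ^ 2 / (2 * M))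
      ((x - s) / (x * (1 - x)) - (x - s) / M) x := by
  refine ((hasDerivAt_Kfun hs hx).sub
    ((((hasDerivAt_id x).sub_const s).pow 2).div_const (2 * M))).congr_deriv ?_
  simp only [id]
  rcases eq_or_ne M 0 with rfl | hM
  · simp
  · field_simp
    norm_num
    ring

/-- A generalised Pinsker inequality. -/
theorem sq_div_le_Kfun {s t M : ℝ} (hs : s ∈ Ioo (0 : ℝ) 1) (hst : s ≤ t) (ht : t < 1)
    (hM : ∀ x ∈ Icc s t, x * (1 - x) ≤ M) : (t - s) ^ 2 / (2 * M) ≤ Kfun s t := by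
  have hmem : ∀ x ∈ Icc s t, x ∈ Ioo (0 : ℝ) 1 :=
    fun x hx => ⟨hs.1.trans_le hx.1, hx.2.trans_lt ht⟩
  have hmono : MonotoneOn (fun y => Kfun s y - (y - s) ^ 2 / (2 * M)) (Icc s t) := by
    refine monotoneOn_of_hasDerivWithinAt_nonneg (convex_Icc s t)
      (fun x hx => (hasDerivAt_Kfun_sub_sq M hs (hmem x hx)).continuousAt.continuousWithinAt)
      (fun x hx => (hasDerivAt_Kfun_sub_sq M hs
        (hmem x (interior_subset hx))).hasDerivWithinAt) fun x hx => ?_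
    have hx := interior_subset hx
    have hpos : 0 < x * (1 - x) := mul_pos (hmem x hx).1 (by linarith [(hmem x hx).2])
    have := div_le_div_of_nonneg_left (sub_nonneg.2 hx.1) hpos (hM x hx)
    linarith
  have := hmono (left_mem_Icc.2 hst) (right_mem_Icc.2 hst) hst
  simp only [Kfun_self hs, sub_self] at this
  norm_num at this
  linarith

theorem Kfun_le_sq_div {s t m : ℝ} (hs : s ∈ Ioo (0 : ℝ) 1) (hst : s ≤ t) (ht : t < 1)
    (hm0 : 0 < m) (hm : ∀ x ∈ Icc s t, m ≤ x * (1 - x)) :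
    Kfun s t ≤ (t - s) ^ 2 / (2 * m) := by
  have hmem : ∀ x ∈ Icc s t, x ∈ Ioo (0 : ℝ) 1 :=
    fun x hx => ⟨hs.1.trans_le hx.1, hx.2.trans_lt ht⟩
  have hanti : AntitoneOn (fun y => Kfun s y - (y - s) ^ 2 / (2 * m)) (Icc s t) := by
    refine antitoneOn_of_hasDerivWithinAt_nonpos (convex_Icc s t)
      (fun x hx => (hasDerivAt_Kfun_sub_sq m hs (hmem x hx)).continuousAt.continuousWithinAt)
      (fun x hx => (hasDerivAt_Kfun_sub_sq m hs
        (hmem x (interior_subset hx))).hasDerivWithinAt) fun x hx => ?_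
    have hx := interior_subset hx
    have := div_le_div_of_nonneg_left (sub_nonneg.2 hx.1) hm0 (hm x hx)
    linarith
  have := hanti (left_mem_Icc.2 hst) (right_mem_Icc.2 hst) hst
  simp only [Kfun_self hs, sub_self] at this
  norm_num at this
  linarith

/-- Pinsker's inequality. -/
theorem sub_le_sqrt_of_Kfun_eq {s t γ : ℝ} (hs : s ∈ Ioo (0 : ℝ) 1) (hst : s ≤ t) (ht : t < 1)
    (h : Kfun s t = γ) : t - s ≤ √(γ / 2) := by
  have := sq_div_le_Kfun (M := 1 / 4) hs hst ht fun x _ => by nlinarith [sq_nonneg (x - 1 / 2)]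
  apply Real.le_sqrt_of_sq_le
  rw [h, div_le_iff₀ (by norm_num)] at this
  linarith

theorem sqrt_le_sub_of_Kfun_eq {s t γ m : ℝ} (hs : s ∈ Ioo (0 : ℝ) 1) (hst : s ≤ t) (ht : t < 1)
    (hm0 : 0 < m) (hm : ∀ x ∈ Icc s t, m ≤ x * (1 - x)) (h : Kfun s t = γ) :
    √(2 * m * γ) ≤ t - s := by
  have := Kfun_le_sq_div hs hst ht hm0 hm
  rw [h, le_div_iff₀ (by positivity)] at this
  refine Real.sqrt_le_iff.2 ⟨sub_nonneg.2 hst, by linarith⟩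

theorem sub_le_max_of_Kfun_eq {s t γ : ℝ} (hs : s ∈ Ioo (0 : ℝ) 1) (hst : s < t) (ht : t < 1)
    (h : Kfun s t = γ) : t - s ≤ max √(4 * (γ * (s * (1 - s)))) (4 * γ) := by
  have hd : 0 < t - s := sub_pos.2 hst
  have hv : 0 < s * (1 - s) := mul_pos hs.1 (by linarith [hs.2])
  have hle := sq_div_le_Kfun (M := s * (1 - s) + (t - s)) hs hst.le ht fun x hx => by
    nlinarith [hx.1, hx.2, hs.1, mul_nonneg (sub_nonneg.2 hx.1)
      (add_nonneg (hs.1.le.trans hx.1) hs.1.le)]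
  rw [h, div_le_iff₀ (by positivity)] at hle
  have hγ : 0 < γ := by
    by_contra hγ
    nlinarith [pow_pos hd 2, mul_nonneg (neg_nonneg.2 (not_lt.1 hγ)) (add_pos hv hd).le]
  rw [le_max_iff]
  rcases le_total (s * (1 - s)) (t - s) with hc | hc
  · right
    nlinarith [mul_le_mul_of_nonneg_left hc hγ.le]
  · left
    apply Real.le_sqrt_of_sq_le
    nlinarith [mul_le_mul_of_nonneg_left hc hγ.le]

theorem Cfun_nonneg {t : ℝ} (ht : t ∈ Ioo (0 : ℝ) 1) : 0 ≤ Cfun t := by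
  have hv : 0 < t * (1 - t) := mul_pos ht.1 (by linarith [ht.2])
  apply Real.log_nonneg
  rw [Real.le_log_iff_exp_le (div_pos (Real.exp_pos 1) (by linarith)),
    le_div_iff₀ (by linarith)]
  nlinarith [Real.exp_pos 1, sq_nonneg (2 * t - 1)]

theorem Dfun_nonneg (t : ℝ) : 0 ≤ Dfun t :=
  Real.log_nonneg (by nlinarith [sq_nonneg (Cfun t)])

theorem Cfun_le {t : ℝ} (ht : t ∈ Ioo (0 : ℝ) 1) : Cfun t ≤ 1 / √(t * (1 - t)) := by
  have hv : 0 < t * (1 - t) := mul_pos ht.1 (by linarith [ht.2])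
  have hw : 0 < √(t * (1 - t)) := Real.sqrt_pos.2 hv
  have hlog : Real.log (Real.exp 1 / (4 * t * (1 - t)))
      = 1 + 2 * Real.log (1 / (2 * √(t * (1 - t)))) := by
    have h4 : 4 * t * (1 - t) = (2 * √(t * (1 - t))) ^ 2 := by
      rw [mul_pow, Real.sq_sqrt hv.le]; ring
    rw [h4, Real.log_div (Real.exp_pos 1).ne' (by positivity), Real.log_exp, Real.log_pow,
      one_div, Real.log_inv]
    push_cast
    ring
  have hle : √(t * (1 - t)) ≤ 1 / 2 :=
    Real.sqrt_le_iff.2 ⟨by norm_num, by nlinarith [sq_nonneg (2 * t - 1)]⟩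
  have hlog0 : 0 ≤ Real.log (1 / (2 * √(t * (1 - t)))) :=
    Real.log_nonneg ((one_le_div (by positivity)).2 (by linarith))
  have h₁ := Real.log_le_sub_one_of_pos (show 0 < 1 / (2 * √(t * (1 - t))) by positivity)
  have h₂ := Real.log_le_sub_one_of_pos
    (show 0 < 1 + 2 * Real.log (1 / (2 * √(t * (1 - t)))) by linarith)
  have h₃ : 1 / (2 * √(t * (1 - t))) = 1 / √(t * (1 - t)) / 2 := by
    field_simp
  rw [Cfun, hlog]
  linarith

theorem Dfun_le {t : ℝ} (ht : t ∈ Ioo (0 : ℝ) 1) : Dfun t ≤ 2 * Cfun t := by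
  have hC := Cfun_nonneg ht
  have h₁ : Dfun t ≤ Real.log ((1 + Cfun t) ^ 2) :=
    Real.log_le_log (by positivity) (by nlinarith)
  have h₂ := Real.log_le_sub_one_of_pos (show 0 < 1 + Cfun t by linarith)
  rw [Real.log_pow] at h₁
  push_cast at h₁
  linarith

theorem Cfun_add_Dfun_add_le {t ν κ B : ℝ} (ht : t ∈ Ioo (0 : ℝ) 1) (hν : 0 ≤ ν)
    (hκ : κ ≤ B) (hB : 0 ≤ B) :
    Cfun t + ν * Dfun t + κ ≤ (1 + 2 * ν + B) / √(t * (1 - t)) := by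
  have hv : 0 < t * (1 - t) := mul_pos ht.1 (by linarith [ht.2])
  have hw : 0 < √(t * (1 - t)) := Real.sqrt_pos.2 hv
  have hle : √(t * (1 - t)) ≤ 1 :=
    Real.sqrt_le_iff.2 ⟨by norm_num, by nlinarith [sq_nonneg (2 * t - 1)]⟩
  have h₁ : 1 ≤ 1 / √(t * (1 - t)) := (one_le_div hw).2 hle
  have h₂ := Cfun_le ht
  have h₃ := Dfun_le ht
  have h₄ : ν * Dfun t ≤ ν * (2 * (1 / √(t * (1 - t)))) :=
    mul_le_mul_of_nonneg_left (by linarith) hν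
  have h₅ : B * 1 ≤ B * (1 / √(t * (1 - t))) := mul_le_mul_of_nonneg_left h₁ hB
  rw [div_eq_mul_one_div]
  linarith

theorem one_sub_exp_neg_le_sqrt {γ : ℝ} (h0 : 0 ≤ γ) (h : γ ≤ 1 / 2) :
    1 - Real.exp (-γ) ≤ √(γ / 2) := by
  have := Real.add_one_le_exp (-γ)
  apply le_trans (show 1 - Real.exp (-γ) ≤ γ by linarith)
  apply Real.le_sqrt_of_sq_le
  nlinarith

/-- The solution of `K(s, ·) = γ` exceeds `s` by at most a multiple of `n^{-1/2}` when `γ` is of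
order `1 / (n √(s (1 - s)))` and `s (1 - s)` is at least of order `1 / n`. -/
theorem sub_le_div_sqrt_of_Kfun_eq {s t γ A n : ℝ} (hs : s ∈ Ioo (0 : ℝ) 1) (hst : s < t)
    (ht : t < 1) (h : Kfun s t = γ) (hA : 1 ≤ A) (hn : 0 < n)
    (hγ : γ ≤ A / √(s * (1 - s)) / (n + 1)) (hsn : n / (n + 1) ^ 2 ≤ s * (1 - s)) :
    t - s ≤ 4 * A / √n := by
  have hv : 0 < s * (1 - s) := mul_pos hs.1 (by linarith [hs.2])
  have hw : 0 < √(s * (1 - s)) := Real.sqrt_pos.2 hv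
  have hw1 : √(s * (1 - s)) ≤ 1 :=
    Real.sqrt_le_iff.2 ⟨by norm_num, by nlinarith [sq_nonneg (2 * s - 1)]⟩
  have hr : 0 < √n := Real.sqrt_pos.2 hn
  have hA0 : 0 < A := by linarith
  have hwn : √n / (n + 1) ≤ √(s * (1 - s)) := by
    apply Real.le_sqrt_of_sq_le
    rwa [div_pow, Real.sq_sqrt hn.le]
  refine (sub_le_max_of_Kfun_eq hs hst ht h).trans (max_le ?_ ?_)
  · refine Real.sqrt_le_iff.2 ⟨by positivity, ?_⟩
    have h₁ : γ * (s * (1 - s)) ≤ A / n := by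
      calc γ * (s * (1 - s)) ≤ A / √(s * (1 - s)) / (n + 1) * (s * (1 - s)) := by gcongr
        _ = A * √(s * (1 - s)) / (n + 1) := by
            field_simp
            rw [Real.sq_sqrt hv.le]
        _ ≤ A * 1 / n := by gcongr; linarith
        _ = A / n := by rw [mul_one]
    rw [div_pow, Real.sq_sqrt hn.le]
    calc 4 * (γ * (s * (1 - s))) ≤ 4 * (A / n) := by linarith
      _ = 4 * A / n := by ring
      _ ≤ (4 * A) ^ 2 / n := by gcongr; nlinarith
  · have h₁ : γ ≤ A / √n := by
      refine hγ.trans ?_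
      rw [div_div]
      gcongr
      rwa [div_le_iff₀ (by positivity)] at hwn
    calc 4 * γ ≤ 4 * (A / √n) := by linarith
      _ = 4 * A / √n := by ring

/-- Second part of Theorem 5.1 of Dümbgen–Wellner: let `b(s,γ)` be the unique solution
`b ∈ (s,1)` of `K(s,b) = γ` for `s ∈ (0,1)`, `γ > 0`, with `b(0,γ) = 1 − e^{−γ}` and the
continuous extension `b(s,0) = s`.
(i) If `(γ_n)` are positive reals with `n γ_n / log log n → 1`, then
`max_{0 ≤ j < n} ( b(j/n, γ_n) − j/n ) / √( (log log n)/(2n) ) → 1`.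
(ii) For fixed `ν > 1` and a bounded sequence `(κ_n)` of nonnegative reals, setting
`γ_n(t) = (C(t) + ν D(t) + κ_n)/(n+1)`, one has
`max_{0 ≤ j < n} ( b((j+1)/(n+1), γ_n((j+1)/(n+1))) − j/n ) = O(n^{−1/2})`. -/
theorem stmt12
    (b : ℝ → ℝ → ℝ)
    (hb0 : ∀ γ : ℝ, 0 < γ → b 0 γ = 1 - Real.exp (-γ))
    (hb : ∀ s : ℝ, s ∈ Set.Ioo (0:ℝ) 1 → ∀ γ : ℝ, 0 < γ →
      b s γ ∈ Set.Ioo s 1 ∧ Kfun s (b s γ) = γ)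
    (hbz : ∀ s : ℝ, s ∈ Set.Ioo (0:ℝ) 1 → b s 0 = s)
    (γ : ℕ → ℝ) (hγ : ∀ n : ℕ, 16 ≤ n → 0 < γ n)
    (hγlim : Filter.Tendsto (fun n : ℕ => (n : ℝ) * γ n / Real.log (Real.log n))
      Filter.atTop (nhds 1))
    (ν : ℝ) (hν : 1 < ν)
    (κ : ℕ → ℝ) (hκ0 : ∀ n, 0 ≤ κ n) (hκbdd : ∃ Kb : ℝ, ∀ n, κ n ≤ Kb) :
    Filter.Tendsto (fun n : ℕ =>
        (⨆ j : Fin n, (b ((j : ℝ) / n) (γ n) - (j : ℝ) / n))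
          / Real.sqrt (Real.log (Real.log n) / (2 * n)))
      Filter.atTop (nhds 1)
    ∧
    ∃ C₀ : ℝ, 0 < C₀ ∧ ∀ᶠ n : ℕ in Filter.atTop,
      (⨆ j : Fin n,
        (b (((j : ℝ) + 1) / ((n : ℝ) + 1))
            ((Cfun (((j : ℝ) + 1) / ((n : ℝ) + 1))
              + ν * Dfun (((j : ℝ) + 1) / ((n : ℝ) + 1)) + κ n) / ((n : ℝ) + 1))
          - (j : ℝ) / n))
        ≤ C₀ / Real.sqrt n := by
  have hn_top : Tendsto (fun n : ℕ => (n : ℝ)) atTop atTop := tendsto_natCast_atTop_atTop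
  refine ⟨?_, ?_⟩
  · have hLpos : ∀ᶠ n : ℕ in atTop, 0 < Real.log (Real.log n) :=
      ((Real.tendsto_log_atTop.comp Real.tendsto_log_atTop).comp hn_top).eventually_gt_atTop 0
    have hLn : Tendsto (fun n : ℕ => Real.log (Real.log n) / (n : ℝ)) atTop (nhds 0) := by
      have h₁ : Tendsto (fun x : ℝ => Real.log (Real.log x) / x) atTop (nhds 0) :=
        ((Real.isLittleO_log_id_atTop.comp_tendsto Real.tendsto_log_atTop).trans
          Real.isLittleO_log_id_atTop).tendsto_div_nhds_zero
      exact h₁.comp hn_top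
    have hγ0 : Tendsto γ atTop (nhds 0) := by
      have := hγlim.mul hLn
      rw [one_mul] at this
      refine this.congr' ?_
      filter_upwards [hLpos, eventually_gt_atTop 0] with n hL hn
      have : (n : ℝ) ≠ 0 := by positivity
      field_simp
    have hδ : Tendsto (fun n : ℕ => 1 / (n : ℝ) + √(γ n / 2)) atTop (nhds 0) := by
      have h₁ := tendsto_one_div_atTop_nhds_zero_nat (𝕜 := ℝ)
      have h₂ := (hγ0.div_const 2).sqrt
      simpa using h₁.add h₂
    have hm : Tendsto (fun n : ℕ => 1 / 4 - (1 / (n : ℝ) + √(γ n / 2)) ^ 2) atTop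
        (nhds (1 / 4)) := by
      have := (hδ.pow 2).const_sub (1 / 4)
      rwa [zero_pow two_ne_zero, sub_zero] at this
    have hlow : Tendsto (fun n : ℕ => √(4 * (1 / 4 - (1 / (n : ℝ) + √(γ n / 2)) ^ 2)
        * ((n : ℝ) * γ n / Real.log (Real.log n)))) atTop (nhds 1) := by
      simpa using ((hm.const_mul 4).mul hγlim).sqrt
    have hupp : Tendsto (fun n : ℕ => √((n : ℝ) * γ n / Real.log (Real.log n))) atTop
        (nhds 1) := by
      simpa using hγlim.sqrt
    have hpt : ∀ᶠ n : ℕ in atTop, ∀ j : Fin n,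
        b ((j : ℝ) / n) (γ n) - (j : ℝ) / n ≤ √(γ n / 2) := by
      filter_upwards [eventually_ge_atTop 16,
        hγ0.eventually_le_const (show (0 : ℝ) < 1 / 2 by norm_num)]
        with n hn hγn j
      have hn0 : (0 : ℝ) < n := by positivity
      rcases Nat.eq_zero_or_pos (j : ℕ) with hj | hj
      · simpa [hj, hb0 _ (hγ n hn)] using one_sub_exp_neg_le_sqrt (hγ n hn).le hγn
      · have hs : (j : ℝ) / n ∈ Ioo (0 : ℝ) 1 :=
          ⟨by positivity, (div_lt_one hn0).2 (by exact_mod_cast j.2)⟩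
        obtain ⟨h₁, h₂⟩ := hb _ hs _ (hγ n hn)
        exact sub_le_sqrt_of_Kfun_eq hs h₁.1.le h₁.2 h₂
    refine tendsto_of_tendsto_of_tendsto_of_le_of_le' hlow hupp ?_ ?_
    · filter_upwards [hLpos, eventually_ge_atTop 16, hpt,
        hm.eventually_const_lt (show (0 : ℝ) < 1 / 4 by norm_num)] with n hL hn hptn hmn
      have hn0 : (0 : ℝ) < n := by positivity
      have hj : n / 2 < n := by omega
      have hs1 : ((n / 2 : ℕ) : ℝ) / n ≤ 1 / 2 := by
        rw [div_le_iff₀ hn0]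
        have : ((n / 2 : ℕ) : ℝ) * 2 ≤ n := by exact_mod_cast Nat.div_mul_le_self n 2
        linarith
      have hs2 : 1 / 2 - 1 / (n : ℝ) ≤ ((n / 2 : ℕ) : ℝ) / n := by
        rw [le_div_iff₀ hn0, sub_mul, div_mul_cancel₀ _ hn0.ne']
        have : (n : ℝ) ≤ 2 * (n / 2 : ℕ) + 1 := by
          exact_mod_cast (show n ≤ 2 * (n / 2) + 1 by omega)
        linarith
      have hs : ((n / 2 : ℕ) : ℝ) / n ∈ Ioo (0 : ℝ) 1 := by
        refine ⟨div_pos ?_ hn0, by linarith⟩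
        exact_mod_cast (show 0 < n / 2 by omega)
      obtain ⟨h₁, h₂⟩ := hb _ hs _ (hγ n hn)
      have hup := hptn ⟨n / 2, hj⟩
      have hle : √(2 * (1 / 4 - (1 / (n : ℝ) + √(γ n / 2)) ^ 2) * γ n)
          ≤ b (((n / 2 : ℕ) : ℝ) / n) (γ n) - ((n / 2 : ℕ) : ℝ) / n := by
        refine sqrt_le_sub_of_Kfun_eq hs h₁.1.le h₁.2 hmn (fun x hx => ?_) h₂
        have hx1 : x - 1 / 2 ≤ 1 / (n : ℝ) + √(γ n / 2) := by
          have : 0 < 1 / (n : ℝ) := by positivity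
          simp only at hup
          linarith [hx.2]
        have hx2 : -(1 / (n : ℝ) + √(γ n / 2)) ≤ x - 1 / 2 := by
          linarith [hx.1, Real.sqrt_nonneg (γ n / 2)]
        have := sq_le_sq' hx2 hx1
        nlinarith
      have hsup := le_ciSup (f := fun j : Fin n => b ((j : ℝ) / n) (γ n) - (j : ℝ) / n)
        (Set.finite_range _).bddAbove ⟨n / 2, hj⟩
      rw [le_div_iff₀ (Real.sqrt_pos.2 (by positivity)), ← Real.sqrt_mul' _ (by positivity)]
      refine le_trans (le_of_eq ?_) (hle.trans hsup)
      congr 1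
      field_simp
      ring
    · filter_upwards [hLpos, eventually_ge_atTop 16, hpt] with n hL hn hptn
      have hn0 : (0 : ℝ) < n := by positivity
      have : Nonempty (Fin n) := ⟨⟨0, by omega⟩⟩
      rw [div_le_iff₀ (Real.sqrt_pos.2 (by positivity)), ← Real.sqrt_mul' _ (by positivity)]
      refine (ciSup_le hptn).trans (le_of_eq ?_)
      congr 1
      field_simp
  · obtain ⟨B, hB⟩ := hκbdd
    have hB0 : 0 ≤ B := (hκ0 0).trans (hB 0)
    refine ⟨4 * (1 + 2 * ν + B) + 1, by linarith, ?_⟩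
    filter_upwards [eventually_ge_atTop 1] with n hn
    have : Nonempty (Fin n) := ⟨⟨0, by omega⟩⟩
    have hn1 : (1 : ℝ) ≤ n := by exact_mod_cast hn
    have hn0 : (0 : ℝ) < n := by linarith
    refine ciSup_le fun j => ?_
    have hj0 : (0 : ℝ) ≤ j := by positivity
    have hj1 : (j : ℝ) + 1 ≤ n := by exact_mod_cast j.2
    have hshift : ((j : ℝ) + 1) / (n + 1) - (j : ℝ) / n ≤ 1 / √n := by
      have h₁ : ((j : ℝ) + 1) / (n + 1) - (j : ℝ) / n ≤ 1 / n := by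
        rw [sub_le_iff_le_add, ← add_div]
        rw [add_comm (1 : ℝ)]
        gcongr
        linarith
      refine h₁.trans (one_div_le_one_div_of_le (Real.sqrt_pos.2 hn0) ?_)
      exact Real.sqrt_le_iff.2 ⟨hn0.le, by nlinarith⟩
    have hs : ((j : ℝ) + 1) / (n + 1) ∈ Ioo (0 : ℝ) 1 :=
      ⟨by positivity, (div_lt_one (by positivity)).2 (by linarith)⟩
    have hv : (n : ℝ) / (n + 1) ^ 2
        ≤ ((j : ℝ) + 1) / (n + 1) * (1 - ((j : ℝ) + 1) / (n + 1)) := by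
      have : ((j : ℝ) + 1) / (n + 1) * (1 - ((j : ℝ) + 1) / (n + 1))
          = ((j + 1) * (n - j)) / ((n : ℝ) + 1) ^ 2 := by
        field_simp
        ring
      rw [this]
      gcongr
      nlinarith
    have hL := Cfun_add_Dfun_add_le hs (by linarith : 0 ≤ ν) (hB n) hB0
    have hL0 : 0 ≤ Cfun (((j : ℝ) + 1) / ((n : ℝ) + 1))
        + ν * Dfun (((j : ℝ) + 1) / ((n : ℝ) + 1)) + κ n :=
      add_nonneg (add_nonneg (Cfun_nonneg hs) (mul_nonneg (by linarith) (Dfun_nonneg _))) (hκ0 n)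
    set s := ((j : ℝ) + 1) / ((n : ℝ) + 1)
    set L := Cfun s + ν * Dfun s + κ n
    have hbs : b s (L / (n + 1)) - s ≤ 4 * (1 + 2 * ν + B) / √n := by
      rcases hL0.eq_or_lt with h0 | h0
      · rw [← h0, zero_div, hbz s hs, sub_self]
        positivity
      · obtain ⟨h₁, h₂⟩ := hb s hs (L / (n + 1)) (by positivity)
        exact sub_le_div_sqrt_of_Kfun_eq hs h₁.1 h₁.2 h₂ (by linarith) hn0 (by gcongr) hv
    rw [add_div (4 * (1 + 2 * ν + B))]
    linarith
end

section
/- The functions H : [0,∞) → [0,∞) and H̃ : [0,1) → [0,∞) are bijective, strictly increasing and strictly convex. Moreover, H(x) ∈ [ 1 + x − √(1+2x), x²/(2+x) ] for all x ≥ 0, and H̃(z) ∈ [ −log(1−z²)/2, −log(1−z) ] for all z ∈ [0,1). The inverse functions H^{−1} : [0,∞) → [0,∞) and H̃^{−1} : [0,∞) → [0,1) are strictly increasing and strictly concave, with H^{−1}(y) ∈ [ √(2y + y²/4) + y/2, √(2y) + y ] and H̃^{−1}(y) ∈ [ 1 − e^{−y}, √(1 − e^{−2y}) ] for all y ≥ 0.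 -/
open Set

/-- H(x) = x − log(1+x). -/
noncomputable def Hfun (x : ℝ) : ℝ := x - Real.log (1 + x)

/-- H̃(z) = −log(1−z) − z. -/
noncomputable def Htfun (z : ℝ) : ℝ := -Real.log (1 - z) - z

/-- The inverse of a strictly increasing function is strictly increasing. -/
lemma strictMonoOn_of_rightInverse {f g : ℝ → ℝ} {s t : Set ℝ} (hf : StrictMonoOn f s)
    (hg : ∀ y ∈ t, g y ∈ s ∧ f (g y) = y) : StrictMonoOn g t := by
  intro a ha b hb hab
  rw [← hf.lt_iff_lt (hg a ha).1 (hg b hb).1, (hg a ha).2, (hg b hb).2]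
  exact hab

/-- The inverse of a strictly increasing, strictly convex function is strictly concave. -/
lemma strictConcaveOn_of_rightInverse {f g : ℝ → ℝ} {s t : Set ℝ} (hf : StrictMonoOn f s)
    (hc : StrictConvexOn ℝ s f) (ht : Convex ℝ t)
    (hg : ∀ y ∈ t, g y ∈ s ∧ f (g y) = y) : StrictConcaveOn ℝ t g := by
  refine ⟨ht, fun a ha b hb hab p q hp hq hpq => ?_⟩
  have hm := ht ha hb hp.le hq.le hpq
  have hne : g a ≠ g b := fun h => hab (by rw [← (hg a ha).2, ← (hg b hb).2, h])
  have hlt := hc.2 (hg a ha).1 (hg b hb).1 hne hp hq hpq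
  rw [(hg a ha).2, (hg b hb).2] at hlt
  rw [← hf.lt_iff_lt (hc.1 (hg a ha).1 (hg b hb).1 hp.le hq.le hpq) (hg _ hm).1, (hg _ hm).2]
  exact hlt

lemma Hfun_zero : Hfun 0 = 0 := by simp [Hfun]

lemma Htfun_zero : Htfun 0 = 0 := by simp [Htfun]

lemma continuousOn_Hfun : ContinuousOn Hfun (Ici 0) := by
  unfold Hfun
  exact continuousOn_id.sub (ContinuousOn.log (by fun_prop) fun x (hx : 0 ≤ x) => by positivity)

lemma continuousOn_Htfun : ContinuousOn Htfun (Ico 0 1) := by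
  unfold Htfun
  exact (ContinuousOn.log (by fun_prop) fun x hx => (sub_pos.2 hx.2).ne').neg.sub continuousOn_id

lemma strictMonoOn_Hfun : StrictMonoOn Hfun (Ici 0) := by
  intro a (ha : 0 ≤ a) b (hb : 0 ≤ b) hab
  have hpa : 0 < 1 + a := by linarith
  have hpb : 0 < 1 + b := by linarith
  have h := Real.log_lt_sub_one_of_pos (div_pos hpb hpa)
    (by rw [ne_eq, div_eq_one_iff_eq hpa.ne']; linarith)
  rw [Real.log_div hpb.ne' hpa.ne', div_sub_one hpa.ne'] at h
  have h2 : (1 + b - (1 + a)) / (1 + a) ≤ 1 + b - (1 + a) :=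
    div_le_self (by linarith) (by linarith)
  unfold Hfun
  linarith

lemma strictMonoOn_Htfun : StrictMonoOn Htfun (Ico 0 1) := by
  intro a ha b hb hab
  have hpa : 0 < 1 - a := sub_pos.2 ha.2
  have hpb : 0 < 1 - b := sub_pos.2 hb.2
  have h := Real.log_lt_sub_one_of_pos (div_pos hpb hpa)
    (by rw [ne_eq, div_eq_one_iff_eq hpa.ne']; linarith)
  rw [Real.log_div hpb.ne' hpa.ne', div_sub_one hpa.ne'] at h
  have h2 : (1 - b - (1 - a)) / (1 - a) ≤ 1 - b - (1 - a) := by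
    rw [div_le_iff₀ hpa]
    nlinarith [ha.1]
  unfold Htfun
  linarith

lemma strictConvexOn_Hfun : StrictConvexOn ℝ (Ici 0) Hfun := by
  refine ⟨convex_Ici 0, fun a (ha : 0 ≤ a) b (hb : 0 ≤ b) hab p q hp hq hpq => ?_⟩
  have h := strictConcaveOn_log_Ioi.2 (x := 1 + a) (y := 1 + b) (mem_Ioi.2 (by linarith))
    (mem_Ioi.2 (by linarith)) (by simpa using hab) hp hq hpq
  simp only [smul_eq_mul, Hfun] at h ⊢
  rw [show p * (1 + a) + q * (1 + b) = 1 + (p * a + q * b) by linear_combination hpq] at h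
  linarith

lemma strictConvexOn_Htfun : StrictConvexOn ℝ (Ico 0 1) Htfun := by
  refine ⟨convex_Ico 0 1, fun a ha b hb hab p q hp hq hpq => ?_⟩
  have h := strictConcaveOn_log_Ioi.2 (x := 1 - a) (y := 1 - b) (mem_Ioi.2 (sub_pos.2 ha.2))
    (mem_Ioi.2 (sub_pos.2 hb.2)) (by simpa using hab) hp hq hpq
  simp only [smul_eq_mul, Htfun] at h ⊢
  rw [show p * (1 - a) + q * (1 - b) = 1 - (p * a + q * b) by linear_combination hpq] at h
  linarith

lemma le_Hfun {x : ℝ} (hx : 0 ≤ x) : 1 + x - √(1 + 2 * x) ≤ Hfun x := by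
  have hs : √(1 + 2 * x) ^ 2 = 1 + 2 * x := Real.sq_sqrt (by linarith)
  have h1 : 1 ≤ √(1 + 2 * x) := Real.one_le_sqrt.2 (by linarith)
  have h := Real.quadratic_le_exp_of_nonneg (sub_nonneg.2 h1)
  have : Real.log (1 + x) ≤ √(1 + 2 * x) - 1 := by
    rw [Real.log_le_iff_le_exp (by linarith)]
    nlinarith
  unfold Hfun
  linarith

lemma Hfun_le {x : ℝ} (hx : 0 ≤ x) : Hfun x ≤ x ^ 2 / (2 + x) := by
  have h := Real.le_log_one_add_of_nonneg hx
  have : x ^ 2 / (2 + x) = x - 2 * x / (x + 2) := by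
    field_simp
    ring
  unfold Hfun
  linarith

lemma le_Htfun {z : ℝ} (h0 : 0 ≤ z) (h1 : z < 1) : -Real.log (1 - z ^ 2) / 2 ≤ Htfun z := by
  have hp : 0 < 1 - z := sub_pos.2 h1
  have hq : 0 < 1 + z := by linarith
  have h := Real.le_log_one_add_of_nonneg (x := 2 * z / (1 - z)) (by positivity)
  rw [show 2 * (2 * z / (1 - z)) / (2 * z / (1 - z) + 2) = 2 * z by field_simp; ring,
    show 1 + 2 * z / (1 - z) = (1 + z) / (1 - z) by field_simp; ring,
    Real.log_div hq.ne' hp.ne'] at h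
  rw [show 1 - z ^ 2 = (1 + z) * (1 - z) by ring, Real.log_mul hq.ne' hp.ne', Htfun]
  linarith

lemma Htfun_le {z : ℝ} (h0 : 0 ≤ z) : Htfun z ≤ -Real.log (1 - z) := by
  unfold Htfun
  linarith

lemma le_Hfun_sqrt_add {y : ℝ} (hy : 0 ≤ y) : y ≤ Hfun (√(2 * y) + y) := by
  have hs : √(2 * y) ^ 2 = 2 * y := Real.sq_sqrt (by linarith)
  have h := le_Hfun (x := √(2 * y) + y) (by positivity)
  rw [show 1 + 2 * (√(2 * y) + y) = (1 + √(2 * y)) ^ 2 by linear_combination -hs,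
    Real.sqrt_sq (by positivity)] at h
  linarith

lemma Hfun_sqrt_add_le {y : ℝ} (hy : 0 ≤ y) : Hfun (√(2 * y + y ^ 2 / 4) + y / 2) ≤ y := by
  have hs : √(2 * y + y ^ 2 / 4) ^ 2 = 2 * y + y ^ 2 / 4 := Real.sq_sqrt (by positivity)
  refine (Hfun_le (by positivity)).trans_eq ?_
  rw [div_eq_iff (by positivity)]
  linear_combination hs

lemma sqrt_one_sub_exp_mem {y : ℝ} (hy : 0 ≤ y) : √(1 - Real.exp (-(2 * y))) ∈ Ico (0 : ℝ) 1 := by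
  refine ⟨Real.sqrt_nonneg _, ?_⟩
  rw [Real.sqrt_lt' one_pos]
  linarith [Real.exp_pos (-(2 * y))]

lemma le_Htfun_sqrt {y : ℝ} (hy : 0 ≤ y) : y ≤ Htfun √(1 - Real.exp (-(2 * y))) := by
  have hm := sqrt_one_sub_exp_mem hy
  have h := le_Htfun hm.1 hm.2
  have he : Real.exp (-(2 * y)) ≤ 1 := Real.exp_le_one_iff.2 (by linarith)
  rw [Real.sq_sqrt (sub_nonneg.2 he), sub_sub_cancel, Real.log_exp] at h
  linarith

lemma one_sub_exp_mem {y : ℝ} (hy : 0 ≤ y) : 1 - Real.exp (-y) ∈ Ico (0 : ℝ) 1 :=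
  ⟨sub_nonneg.2 (Real.exp_le_one_iff.2 (by linarith)), sub_lt_self _ (Real.exp_pos _)⟩

lemma Htfun_one_sub_exp_le {y : ℝ} (hy : 0 ≤ y) : Htfun (1 - Real.exp (-y)) ≤ y := by
  have h := Htfun_le (one_sub_exp_mem hy).1
  rwa [sub_sub_cancel, Real.log_exp, neg_neg] at h

lemma bijOn_Hfun : BijOn Hfun (Ici 0) (Ici 0) := by
  refine ⟨fun x hx => ?_, strictMonoOn_Hfun.injOn, fun y (hy : 0 ≤ y) => ?_⟩
  · have h := strictMonoOn_Hfun.monotoneOn self_mem_Ici hx hx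
    rwa [Hfun_zero] at h
  · have hb : 0 ≤ √(2 * y) + y := by positivity
    obtain ⟨x, hx, hxy⟩ := intermediate_value_Icc hb (continuousOn_Hfun.mono Icc_subset_Ici_self)
      ⟨Hfun_zero.trans_le hy, le_Hfun_sqrt_add hy⟩
    exact ⟨x, hx.1, hxy⟩

lemma bijOn_Htfun : BijOn Htfun (Ico 0 1) (Ici 0) := by
  refine ⟨fun x hx => ?_, strictMonoOn_Htfun.injOn, fun y (hy : 0 ≤ y) => ?_⟩
  · have h := strictMonoOn_Htfun.monotoneOn (left_mem_Ico.2 one_pos) hx hx.1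
    rwa [Htfun_zero] at h
  · have hb := sqrt_one_sub_exp_mem hy
    obtain ⟨x, hx, hxy⟩ := intermediate_value_Icc hb.1
      (continuousOn_Htfun.mono (Icc_subset_Ico_right hb.2))
      ⟨Htfun_zero.trans_le hy, le_Htfun_sqrt hy⟩
    exact ⟨x, ⟨hx.1, hx.2.trans_lt hb.2⟩, hxy⟩

/-- Lemma 6.1 of Dümbgen–Wellner: `H : [0,∞) → [0,∞)` and `H̃ : [0,1) → [0,∞)` are
bijective, strictly increasing and strictly convex, with
`H(x) ∈ [1 + x − √(1+2x), x²/(2+x)]` and `H̃(z) ∈ [−log(1−z²)/2, −log(1−z)]`.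
The inverses `H⁻¹ : [0,∞) → [0,∞)` and `H̃⁻¹ : [0,∞) → [0,1)` are strictly increasing
and strictly concave, with `H⁻¹(y) ∈ [√(2y + y²/4) + y/2, √(2y) + y]` and
`H̃⁻¹(y) ∈ [1 − e^{−y}, √(1 − e^{−2y})]`. -/
theorem stmt13 :
    Set.BijOn Hfun (Set.Ici (0:ℝ)) (Set.Ici (0:ℝ)) ∧
    StrictMonoOn Hfun (Set.Ici (0:ℝ)) ∧
    StrictConvexOn ℝ (Set.Ici (0:ℝ)) Hfun ∧
    (∀ x : ℝ, 0 ≤ x →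
      1 + x - Real.sqrt (1 + 2 * x) ≤ Hfun x ∧ Hfun x ≤ x ^ 2 / (2 + x)) ∧
    Set.BijOn Htfun (Set.Ico (0:ℝ) 1) (Set.Ici (0:ℝ)) ∧
    StrictMonoOn Htfun (Set.Ico (0:ℝ) 1) ∧
    StrictConvexOn ℝ (Set.Ico (0:ℝ) 1) Htfun ∧
    (∀ z : ℝ, 0 ≤ z → z < 1 →
      -Real.log (1 - z ^ 2) / 2 ≤ Htfun z ∧ Htfun z ≤ -Real.log (1 - z)) ∧
    ∃ Hinv Htinv : ℝ → ℝ,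
      (∀ x : ℝ, 0 ≤ x → Hinv (Hfun x) = x) ∧
      (∀ y : ℝ, 0 ≤ y → 0 ≤ Hinv y ∧ Hfun (Hinv y) = y) ∧
      StrictMonoOn Hinv (Set.Ici (0:ℝ)) ∧
      StrictConcaveOn ℝ (Set.Ici (0:ℝ)) Hinv ∧
      (∀ y : ℝ, 0 ≤ y →
        Real.sqrt (2 * y + y ^ 2 / 4) + y / 2 ≤ Hinv y ∧ Hinv y ≤ Real.sqrt (2 * y) + y) ∧
      (∀ z : ℝ, 0 ≤ z → z < 1 → Htinv (Htfun z) = z) ∧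
      (∀ y : ℝ, 0 ≤ y → (0 ≤ Htinv y ∧ Htinv y < 1) ∧ Htfun (Htinv y) = y) ∧
      StrictMonoOn Htinv (Set.Ici (0:ℝ)) ∧
      StrictConcaveOn ℝ (Set.Ici (0:ℝ)) Htinv ∧
      (∀ y : ℝ, 0 ≤ y →
        1 - Real.exp (-y) ≤ Htinv y ∧ Htinv y ≤ Real.sqrt (1 - Real.exp (-(2 * y)))) := by
  have hH := bijOn_Hfun.invOn_invFunOn
  have hT := bijOn_Htfun.invOn_invFunOn
  have gH : ∀ y ∈ Ici (0 : ℝ), Function.invFunOn Hfun (Ici 0) y ∈ Ici (0 : ℝ) ∧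
      Hfun (Function.invFunOn Hfun (Ici 0) y) = y := fun y hy =>
    ⟨bijOn_Hfun.surjOn.mapsTo_invFunOn hy, hH.2 hy⟩
  have gT : ∀ y ∈ Ici (0 : ℝ), Function.invFunOn Htfun (Ico 0 1) y ∈ Ico (0 : ℝ) 1 ∧
      Htfun (Function.invFunOn Htfun (Ico 0 1) y) = y := fun y hy =>
    ⟨bijOn_Htfun.surjOn.mapsTo_invFunOn hy, hT.2 hy⟩
  refine ⟨bijOn_Hfun, strictMonoOn_Hfun, strictConvexOn_Hfun, fun x hx => ⟨le_Hfun hx, Hfun_le hx⟩,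
    bijOn_Htfun, strictMonoOn_Htfun, strictConvexOn_Htfun,
    fun z h0 h1 => ⟨le_Htfun h0 h1, Htfun_le h0⟩,
    Function.invFunOn Hfun (Ici 0), Function.invFunOn Htfun (Ico 0 1),
    fun x hx => hH.1 hx, gH, strictMonoOn_of_rightInverse strictMonoOn_Hfun gH,
    strictConcaveOn_of_rightInverse strictMonoOn_Hfun strictConvexOn_Hfun (convex_Ici 0) gH,
    fun y hy => ⟨?_, ?_⟩,
    fun z h0 h1 => hT.1 ⟨h0, h1⟩, gT, strictMonoOn_of_rightInverse strictMonoOn_Htfun gT,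
    strictConcaveOn_of_rightInverse strictMonoOn_Htfun strictConvexOn_Htfun (convex_Ici 0) gT,
    fun y hy => ⟨?_, ?_⟩⟩
  · rw [← strictMonoOn_Hfun.le_iff_le (mem_Ici.2 (by positivity)) (gH y hy).1, (gH y hy).2]
    exact Hfun_sqrt_add_le hy
  · rw [← strictMonoOn_Hfun.le_iff_le (gH y hy).1 (mem_Ici.2 (by positivity)), (gH y hy).2]
    exact le_Hfun_sqrt_add hy
  · rw [← strictMonoOn_Htfun.le_iff_le (one_sub_exp_mem hy) (gT y hy).1, (gT y hy).2]
    exact Htfun_one_sub_exp_le hy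
  · rw [← strictMonoOn_Htfun.le_iff_le (gT y hy).1 (sqrt_one_sub_exp_mem hy), (gT y hy).2]
    exact le_Htfun_sqrt hy
end

section
/- For every fixed u ∈ (0,1) and all 0 < t < t' < 1, each of the three ratios K(0,t')/K(0,t), K(t'·u, t')/K(t·u, t) and K(t', t'·u)/K(t, t·u) lies in the open interval ( t'/t, t'(1−t)/((1−t')·t) ). -/
open Set

/-- A function on `[0,1)` that is nonnegative at `0` and has positive derivative on `(0,1)` is
positive on `(0,1)`. -/
lemma pos_of_hasDerivAt_pos {g g' : ℝ → ℝ} (hg : ∀ t ∈ Ico (0 : ℝ) 1, HasDerivAt g (g' t) t)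
    (hg' : ∀ t ∈ Ioo (0 : ℝ) 1, 0 < g' t) (h0 : 0 ≤ g 0) :
    ∀ t ∈ Ioo (0 : ℝ) 1, 0 < g t := by
  have hmono : StrictMonoOn g (Ico 0 1) := by
    refine strictMonoOn_of_deriv_pos (convex_Ico 0 1)
      (fun t ht => (hg t ht).continuousAt.continuousWithinAt) fun t ht => ?_
    rw [interior_Ico] at ht
    rw [(hg t (Ioo_subset_Ico_self ht)).deriv]
    exact hg' t ht
  exact fun t ht => h0.trans_lt (hmono (left_mem_Ico.2 one_pos) (Ioo_subset_Ico_self ht) ht.1)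

/-- A function with positive derivative on `(0,1)` is strictly increasing there. -/
lemma strictMonoOn_Ioo_of_hasDerivAt_pos {g g' : ℝ → ℝ}
    (hg : ∀ t ∈ Ioo (0 : ℝ) 1, HasDerivAt g (g' t) t)
    (hg' : ∀ t ∈ Ioo (0 : ℝ) 1, 0 < g' t) : StrictMonoOn g (Ioo 0 1) := by
  refine strictMonoOn_of_deriv_pos (convex_Ioo 0 1)
    (fun t ht => (hg t ht).continuousAt.continuousWithinAt) fun t ht => ?_
  rw [interior_Ioo] at ht
  rw [(hg t ht).deriv]
  exact hg' t ht

/-- If `f` has first and second derivatives `f₁`, `f₂` on `[0,1)` with `f 0 = 0`, `0 ≤ f₁ 0`, and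
`0 < f₂`, `(1 - t) f₂ t < 2 f₁ t` on `(0,1)`, then `t ↦ f t / t` is strictly increasing and
`t ↦ f t (1 - t) / t` is strictly decreasing on `(0,1)`; here in the form of bounds on ratios. -/
lemma ratio_mem_Ioo {f f₁ f₂ : ℝ → ℝ} (hf : ∀ t ∈ Ico (0 : ℝ) 1, HasDerivAt f (f₁ t) t)
    (hf₁ : ∀ t ∈ Ico (0 : ℝ) 1, HasDerivAt f₁ (f₂ t) t) (h0 : f 0 = 0) (h1 : 0 ≤ f₁ 0)
    (h2 : ∀ t ∈ Ioo (0 : ℝ) 1, 0 < f₂ t)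
    (h3 : ∀ t ∈ Ioo (0 : ℝ) 1, 0 < 2 * f₁ t - (1 - t) * f₂ t)
    {t t' : ℝ} (ht : 0 < t) (htt' : t < t') (ht' : t' < 1) :
    f t' / f t ∈ Ioo (t' / t) (t' * (1 - t) / ((1 - t') * t)) := by
  have pos : ∀ t ∈ Ioo (0 : ℝ) 1, 0 < f t :=
    pos_of_hasDerivAt_pos hf (pos_of_hasDerivAt_pos hf₁ h2 h1) h0.ge
  have key₁ : ∀ t ∈ Ioo (0 : ℝ) 1, 0 < t * f₁ t - f t := by
    refine pos_of_hasDerivAt_pos (g' := fun t => t * f₂ t) (fun t ht => ?_)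
      (fun t ht => mul_pos ht.1 (h2 t ht)) (by simp [h0])
    refine (((hasDerivAt_id t).mul (hf₁ t ht)).sub (hf t ht)).congr_deriv ?_
    simp
  have key₂ : ∀ t ∈ Ioo (0 : ℝ) 1, 0 < f t - t * (1 - t) * f₁ t := by
    refine pos_of_hasDerivAt_pos (g' := fun t => t * (2 * f₁ t - (1 - t) * f₂ t)) (fun t ht => ?_)
      (fun t ht => mul_pos ht.1 (h3 t ht)) (by simp [h0])
    refine ((hf t ht).sub (((hasDerivAt_id t).mul
      ((hasDerivAt_id t).const_sub 1)).mul (hf₁ t ht))).congr_deriv ?_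
    simp only [id, Pi.mul_apply]
    ring
  have mono₁ : StrictMonoOn (fun t => f t / t) (Ioo 0 1) := by
    refine strictMonoOn_Ioo_of_hasDerivAt_pos (g' := fun t => (t * f₁ t - f t) / t ^ 2)
      (fun t ht => ?_) (fun t ht => div_pos (key₁ t ht) (pow_pos ht.1 2))
    refine ((hf t (Ioo_subset_Ico_self ht)).div (hasDerivAt_id t) ht.1.ne').congr_deriv ?_
    simp only [id_eq]
    ring
  have mono₂ : StrictMonoOn (fun t => -(f t * (1 - t) / t)) (Ioo 0 1) := by
    refine strictMonoOn_Ioo_of_hasDerivAt_pos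
      (g' := fun t => (f t - t * (1 - t) * f₁ t) / t ^ 2)
      (fun t ht => ?_) (fun t ht => div_pos (key₂ t ht) (pow_pos ht.1 2))
    refine ((((hf t (Ioo_subset_Ico_self ht)).mul ((hasDerivAt_id t).const_sub 1)).div
      (hasDerivAt_id t) ht.1.ne').neg).congr_deriv ?_
    simp only [id, Pi.mul_apply]
    ring
  have mem : t ∈ Ioo (0 : ℝ) 1 := ⟨ht, htt'.trans ht'⟩
  have mem' : t' ∈ Ioo (0 : ℝ) 1 := ⟨ht.trans htt', ht'⟩
  have lt₁ := mono₁ mem mem' htt'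
  have lt₂ := neg_lt_neg_iff.1 (mono₂ mem mem' htt')
  rw [div_lt_div_iff₀ ht mem'.1] at lt₁
  rw [div_lt_div_iff₀ mem'.1 ht] at lt₂
  have one_sub_pos : 0 < 1 - t' := sub_pos.2 ht'
  constructor
  · rw [div_lt_div_iff₀ ht (pos t mem)]
    linarith
  · rw [div_lt_div_iff₀ (pos t mem) (by positivity)]
    linarith

lemma one_sub_mul_pos {a t : ℝ} (ha : a ≤ 1) (ht : t ∈ Ico (0 : ℝ) 1) : 0 < 1 - t * a := by
  nlinarith [ht.1, ht.2, mul_le_mul_of_nonneg_left ha ht.1]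

lemma hasDerivAt_log_one_sub_mul {a t : ℝ} (h : 1 - t * a ≠ 0) :
    HasDerivAt (fun t => Real.log (1 - t * a)) (-a / (1 - t * a)) t := by
  refine ((((hasDerivAt_id t).mul_const a).const_sub 1).log h).congr_deriv ?_
  simp

lemma Kfun_mul_mul {a b t : ℝ} (ha : a ≤ 1) (hb : b ≤ 1) (ht : t ∈ Ioo (0 : ℝ) 1) :
    Kfun (t * a) (t * b) = t * (a * Real.log (a / b))
      + (1 - t * a) * (Real.log (1 - t * a) - Real.log (1 - t * b)) := by
  have ht₀ := Ioo_subset_Ico_self ht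
  rw [Kfun, mul_div_mul_left _ _ ht.1.ne',
    Real.log_div (one_sub_mul_pos ha ht₀).ne' (one_sub_mul_pos hb ht₀).ne']
  ring

/-- The ratio bounds for `t ↦ K(ta, tb)`, under a condition on the slope of this function at `0`. -/
lemma Kfun_ratio_mem_Ioo {a b : ℝ} (ha : a ≤ 1) (hb : b ≤ 1) (hab : a ≠ b)
    (hc : (a - b) ^ 2 / 2 ≤ a * Real.log (a / b) - a + b)
    {t t' : ℝ} (ht : 0 < t) (htt' : t < t') (ht' : t' < 1) :
    Kfun (t' * a) (t' * b) / Kfun (t * a) (t * b)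
      ∈ Ioo (t' / t) (t' * (1 - t) / ((1 - t') * t)) := by
  rw [Kfun_mul_mul ha hb ⟨ht, htt'.trans ht'⟩, Kfun_mul_mul ha hb ⟨ht.trans htt', ht'⟩]
  generalize a * Real.log (a / b) = c at hc
  have hsq : 0 < (a - b) ^ 2 := by have := sub_ne_zero.2 hab; positivity
  let f : ℝ → ℝ := fun t =>
    t * c + (1 - t * a) * (Real.log (1 - t * a) - Real.log (1 - t * b))
  let f₁ : ℝ → ℝ := fun t =>
    c - a * (Real.log (1 - t * a) - Real.log (1 - t * b)) - a + b * ((1 - t * a) / (1 - t * b))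
  let f₂ : ℝ → ℝ := fun t => (a - b) ^ 2 / ((1 - t * a) * (1 - t * b) ^ 2)
  have lin (x t : ℝ) : HasDerivAt (fun t : ℝ => 1 - t * x) (-x) t := by
    refine (((hasDerivAt_id t).mul_const x).const_sub 1).congr_deriv ?_
    simp
  have hf : ∀ t ∈ Ico (0 : ℝ) 1, HasDerivAt f (f₁ t) t := fun t ht => by
    have pa := (one_sub_mul_pos ha ht).ne'
    have pb := (one_sub_mul_pos hb ht).ne'
    have pa_comm : 1 - a * t ≠ 0 := by rwa [mul_comm]
    refine (((hasDerivAt_id t).mul_const c).add ((lin a t).mul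
      ((hasDerivAt_log_one_sub_mul pa).sub (hasDerivAt_log_one_sub_mul pb)))).congr_deriv ?_
    simp only [f₁, Pi.sub_apply]
    field_simp
    ring
  have hf₁ : ∀ t ∈ Ico (0 : ℝ) 1, HasDerivAt f₁ (f₂ t) t := fun t ht => by
    have pa := (one_sub_mul_pos ha ht).ne'
    have pb := (one_sub_mul_pos hb ht).ne'
    have pa_comm : 1 - a * t ≠ 0 := by rwa [mul_comm]
    refine ((((((hasDerivAt_log_one_sub_mul pa).sub
      (hasDerivAt_log_one_sub_mul pb)).const_mul a).const_sub c).sub_const a).add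
      (((lin a t).div (lin b t) pb).const_mul b)).congr_deriv ?_
    simp only [f₂]
    field_simp
    ring
  have hf₂ : ∀ t ∈ Ico (0 : ℝ) 1,
      HasDerivAt f₂ (f₂ t * (a / (1 - t * a) + 2 * (b / (1 - t * b)))) t := fun t ht => by
    have pa := (one_sub_mul_pos ha ht).ne'
    have pb := (one_sub_mul_pos hb ht).ne'
    refine ((hasDerivAt_const t ((a - b) ^ 2)).div ((lin a t).mul ((lin b t).pow 2))
      (mul_ne_zero pa (pow_ne_zero 2 pb))).congr_deriv ?_
    simp only [f₂, Pi.mul_apply, Pi.pow_apply]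
    field_simp
    ring
  have h2 : ∀ t ∈ Ioo (0 : ℝ) 1, 0 < f₂ t := fun t ht => by
    have pa := one_sub_mul_pos ha (Ioo_subset_Ico_self ht)
    have pb := one_sub_mul_pos hb (Ioo_subset_Ico_self ht)
    positivity
  have frac_le {x t : ℝ} (hx : x ≤ 1) (ht : t ∈ Ioo (0 : ℝ) 1) :
      (1 - t) * (x / (1 - t * x)) ≤ 1 := by
    rw [← mul_div_assoc, div_le_one (one_sub_mul_pos hx (Ioo_subset_Ico_self ht))]
    linarith
  have frac_lt {x t : ℝ} (hx : x < 1) (ht : t ∈ Ioo (0 : ℝ) 1) :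
      (1 - t) * (x / (1 - t * x)) < 1 := by
    rw [← mul_div_assoc, div_lt_one (one_sub_mul_pos hx.le (Ioo_subset_Ico_self ht))]
    linarith
  refine ratio_mem_Ioo hf hf₁ (by simp [f]) (by simp [f₁]; linarith) h2 ?_ ht htt' ht'
  refine pos_of_hasDerivAt_pos (g' := fun t => f₂ t *
    (3 - ((1 - t) * (a / (1 - t * a)) + 2 * ((1 - t) * (b / (1 - t * b)))))) (fun t ht => ?_)
    (fun t ht => mul_pos (h2 t ht) ?_) (by simp [f₁, f₂]; linarith)
  · refine (((hf₁ t ht).const_mul 2).sub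
      (((hasDerivAt_id t).const_sub 1).mul (hf₂ t ht))).congr_deriv ?_
    simp only [id]
    ring
  · rcases ha.lt_or_eq with h | h
    · linarith [frac_lt h ht, frac_le hb ht]
    · linarith [frac_le ha ht, frac_lt (hb.lt_of_ne (h ▸ hab.symm)) ht]

lemma neg_log_one_sub_sub_pos {s : ℝ} (hs : s ∈ Ioo (0 : ℝ) 1) :
    0 < -Real.log (1 - s) - s - s ^ 2 / 2 := by
  refine pos_of_hasDerivAt_pos (g := fun s => -Real.log (1 - s) - s - s ^ 2 / 2)
    (g' := fun s => s ^ 2 / (1 - s)) (fun s hs => ?_)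
    (fun s hs => div_pos (pow_pos hs.1 2) (sub_pos.2 hs.2)) (by simp) s hs
  have h : 1 - s ≠ 0 := (sub_pos.2 hs.2).ne'
  refine ((((((hasDerivAt_id s).const_sub 1).log h).neg.sub (hasDerivAt_id s)).sub
    (((hasDerivAt_id s).pow 2).div_const 2))).congr_deriv ?_
  simp only [id]
  field_simp
  ring

lemma mul_log_one_sub_add_pos {s : ℝ} (hs : s ∈ Ioo (0 : ℝ) 1) :
    0 < (1 - s) * Real.log (1 - s) + s - s ^ 2 / 2 := by
  refine pos_of_hasDerivAt_pos (g := fun s => (1 - s) * Real.log (1 - s) + s - s ^ 2 / 2)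
    (g' := fun s => -Real.log (1 - s) - s) (fun s hs => ?_)
    (fun s hs => by linarith [neg_log_one_sub_sub_pos hs, sq_nonneg s]) (by simp) s hs
  have h : 1 - s ≠ 0 := (sub_pos.2 hs.2).ne'
  refine (((((hasDerivAt_id s).const_sub 1).mul (((hasDerivAt_id s).const_sub 1).log h)).add
    (hasDerivAt_id s)).sub (((hasDerivAt_id s).pow 2).div_const 2)).congr_deriv ?_
  simp only [id]
  field_simp
  ring

/-- Property (K.3) of Dümbgen–Wellner: for fixed `u ∈ (0,1)` and `0 < t < t' < 1`, the
ratios `K(0,t')/K(0,t)`, `K(t'u,t')/K(tu,t)` and `K(t',t'u)/K(t,tu)` all lie in the open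
interval `( t'/t , t'(1−t)/((1−t')t) )`. -/
theorem stmt14 (u : ℝ) (hu : u ∈ Set.Ioo (0:ℝ) 1)
    (t t' : ℝ) (ht : 0 < t) (htt' : t < t') (ht' : t' < 1) :
    Kfun 0 t' / Kfun 0 t ∈ Set.Ioo (t' / t) (t' * (1 - t) / ((1 - t') * t)) ∧
    Kfun (t' * u) t' / Kfun (t * u) t
      ∈ Set.Ioo (t' / t) (t' * (1 - t) / ((1 - t') * t)) ∧
    Kfun t' (t' * u) / Kfun t (t * u)
      ∈ Set.Ioo (t' / t) (t' * (1 - t) / ((1 - t') * t)) := by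
  have hs : 1 - u ∈ Ioo (0 : ℝ) 1 := ⟨sub_pos.2 hu.2, sub_lt_self 1 hu.1⟩
  refine ⟨?_, ?_, ?_⟩
  · simpa using Kfun_ratio_mem_Ioo (a := 0) (b := 1) zero_le_one le_rfl zero_ne_one
      (by norm_num) ht htt' ht'
  · have h := mul_log_one_sub_add_pos hs
    rw [sub_sub_cancel] at h
    simpa using Kfun_ratio_mem_Ioo (a := u) (b := 1) hu.2.le le_rfl hu.2.ne
      (by rw [div_one]; linarith) ht htt' ht'
  · have h := neg_log_one_sub_sub_pos hs
    rw [sub_sub_cancel] at h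
    simpa using Kfun_ratio_mem_Ioo (a := 1) (b := u) le_rfl hu.2.le hu.2.ne'
      (by rw [one_div, Real.log_inv]; linarith) ht htt' ht'
end

section
/- Let X be a real-valued random variable whose moment-generating function m_X(t) := E[exp(t·X)] is finite for all t in some neighborhood of 0, let μ := E[X], and define K : ℝ → [0,∞] by K(x) := sup_{t ∈ ℝ} ( t·x − log m_X(t) ). Then for every η > 0: P( K(X) ≥ η and X ≥ μ ) ≤ exp(−η), P( K(X) ≥ η and X ≤ μ ) ≤ exp(−η), and consequently P( K(X) ≥ η ) ≤ 2·exp(−η). -/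
open MeasureTheory Set
open scoped ENNReal

/-- The moment-generating function `m_X(t) = E exp(t X)`, with values in `(0,∞]`. -/
noncomputable def mgfE {Ω : Type*} [MeasurableSpace Ω] (X : Ω → ℝ) (P : Measure Ω)
    (t : ℝ) : ℝ≥0∞ :=
  ∫⁻ ω, ENNReal.ofReal (Real.exp (t * X ω)) ∂P

/-- The Legendre transform `K(x) = sup_{t ∈ ℝ} ( t x − log m_X(t) )`, with values in
`[0,∞] ⊆ EReal` (the term for `t` is `−∞` whenever `m_X(t) = ∞`). -/
noncomputable def legendreK {Ω : Type*} [MeasurableSpace Ω] (X : Ω → ℝ) (P : Measure Ω)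
    (x : ℝ) : EReal :=
  ⨆ t : ℝ, ((t * x : ℝ) : EReal) - ENNReal.log (mgfE X P t)

theorem integrable_exp_mul_of_mgfE_lt_top {Ω : Type*} [MeasurableSpace Ω] {P : Measure Ω}
    {X : Ω → ℝ} (hX : Measurable X) {t : ℝ} (h : mgfE X P t < ⊤) :
    Integrable (fun ω ↦ Real.exp (t * X ω)) P :=
  ⟨by fun_prop, (hasFiniteIntegral_iff_ofReal (.of_forall fun _ ↦ (Real.exp_pos _).le)).2 h⟩

theorem mgfE_eq_ofReal_mgf {Ω : Type*} [MeasurableSpace Ω] {P : Measure Ω} {X : Ω → ℝ} {t : ℝ}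
    (h : Integrable (fun ω ↦ Real.exp (t * X ω)) P) :
    mgfE X P t = ENNReal.ofReal (ProbabilityTheory.mgf X P t) :=
  (ofReal_integral_eq_lintegral_ofReal h (.of_forall fun _ ↦ (Real.exp_pos _).le)).symm

theorem integrable_of_mgfE_lt_top {Ω : Type*} [MeasurableSpace Ω] {P : Measure Ω}
    {X : Ω → ℝ} (hX : Measurable X)
    (hmgf : ∃ ε : ℝ, 0 < ε ∧ ∀ t : ℝ, |t| < ε → mgfE X P t < ⊤) : Integrable X P := by
  obtain ⟨ε, hε, h⟩ := hmgf
  refine ProbabilityTheory.integrable_of_mem_interior_integrableExpSet ?_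
  refine mem_interior_iff_mem_nhds.2 (Filter.mem_of_superset (Metric.ball_mem_nhds 0 hε) ?_)
  intro t ht
  exact integrable_exp_mul_of_mgfE_lt_top hX (h t (by simpa using ht))

theorem mul_integral_le_log_mgf {Ω : Type*} [MeasurableSpace Ω] {P : Measure Ω}
    [IsProbabilityMeasure P] {X : Ω → ℝ} (hX : Integrable X P) {t : ℝ}
    (h : Integrable (fun ω ↦ Real.exp (t * X ω)) P) :
    t * ∫ ω, X ω ∂P ≤ Real.log (ProbabilityTheory.mgf X P t) := by
  rw [Real.le_log_iff_exp_le (ProbabilityTheory.mgf_pos h), ← integral_const_mul]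
  exact convexOn_exp.map_integral_le Real.continuous_exp.continuousOn isClosed_univ
    (.of_forall fun _ ↦ mem_univ _) (hX.const_mul t) h

theorem exists_lt_of_lt_legendreK {Ω : Type*} [MeasurableSpace Ω] {P : Measure Ω}
    [IsProbabilityMeasure P] {X : Ω → ℝ} (hX : Measurable X) {x δ : ℝ}
    (h : (δ : EReal) < legendreK X P x) :
    ∃ t : ℝ, Integrable (fun ω ↦ Real.exp (t * X ω)) P ∧
      δ < t * x - Real.log (ProbabilityTheory.mgf X P t) := by
  obtain ⟨t, ht⟩ := lt_iSup_iff.1 h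
  have hfin : mgfE X P t < ⊤ := by
    by_contra! htop
    simp [top_le_iff.1 htop] at ht
  have hint := integrable_exp_mul_of_mgfE_lt_top hX hfin
  rw [mgfE_eq_ofReal_mgf hint, ENNReal.log_ofReal_of_pos (ProbabilityTheory.mgf_pos hint),
    ← EReal.coe_sub, EReal.coe_lt_coe_iff] at ht
  exact ⟨t, hint, ht⟩

/-- Chernoff bound at a point above the mean, in terms of the Legendre transform. -/
theorem measureReal_ge_le_exp_neg_of_le_legendreK {Ω : Type*} [MeasurableSpace Ω] {P : Measure Ω}
    [IsProbabilityMeasure P] {X : Ω → ℝ} (hX : Measurable X) (hXi : Integrable X P) {x η : ℝ}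
    (hη : (η : EReal) ≤ legendreK X P x) (hx : ∫ ω, X ω ∂P ≤ x) :
    P.real {ω | x ≤ X ω} ≤ Real.exp (-η) := by
  by_contra! hlt
  have hpos : 0 < P.real {ω | x ≤ X ω} := (Real.exp_pos _).trans hlt
  have hlog : -Real.log (P.real {ω | x ≤ X ω}) < η := by
    have := (Real.lt_log_iff_exp_lt hpos).2 hlt
    linarith
  have hlog_nonpos := Real.log_nonpos hpos.le (measureReal_le_one (μ := P) (s := {ω | x ≤ X ω}))
  obtain ⟨t, hint, ht⟩ :=
    exists_lt_of_lt_legendreK hX ((EReal.coe_lt_coe_iff.2 hlog).trans_le hη)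
  have ht_nonneg : 0 ≤ t := by
    by_contra! hneg
    have := mul_integral_le_log_mgf hXi hint
    nlinarith
  have hle := ProbabilityTheory.measure_ge_le_exp_mul_mgf x ht_nonneg hint
  have hle' := Real.log_le_log hpos hle
  rw [Real.log_mul (Real.exp_ne_zero _) (ProbabilityTheory.mgf_pos hint).ne', Real.log_exp]
    at hle'
  linarith

/-- If every upper tail of `X` starting at a point of `A` has measure at most `p`, then so does
the event `X ∈ A`. -/
theorem measure_mem_le_of_forall_measure_ge_le {Ω : Type*} [MeasurableSpace Ω] {P : Measure Ω}
    {X : Ω → ℝ} {A : Set ℝ} (hA : BddBelow A) {p : ℝ≥0∞}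
    (h : ∀ x ∈ A, P {ω | x ≤ X ω} ≤ p) : P {ω | X ω ∈ A} ≤ p := by
  rcases A.eq_empty_or_nonempty with rfl | hne
  · simp
  by_cases hmem : sInf A ∈ A
  · refine le_trans (measure_mono ?_) (h _ hmem)
    exact fun ω hω ↦ csInf_le hA hω
  obtain ⟨u, hu_anti, hu_lim, hu_mem⟩ := exists_seq_tendsto_sInf hne hA
  have hmono : Monotone fun n ↦ {ω | u n ≤ X ω} :=
    fun m n hmn ω (hω : u m ≤ X ω) ↦ (hu_anti hmn).trans hω
  have hsub : {ω | X ω ∈ A} ⊆ ⋃ n, {ω | u n ≤ X ω} := by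
    intro ω (hω : X ω ∈ A)
    have hlt : sInf A < X ω := (csInf_le hA hω).lt_of_ne fun heq ↦ hmem (heq ▸ hω)
    obtain ⟨n, hn⟩ := (hu_lim.eventually_lt_const hlt).exists
    exact mem_iUnion.2 ⟨n, hn.le⟩
  refine (measure_mono hsub).trans ?_
  rw [hmono.measure_iUnion]
  exact iSup_le fun n ↦ h _ (hu_mem n)

theorem measure_le_legendreK_and_integral_le {Ω : Type*} [MeasurableSpace Ω] {P : Measure Ω}
    [IsProbabilityMeasure P] {X : Ω → ℝ} (hX : Measurable X) (hXi : Integrable X P) (η : ℝ) :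
    P {ω | (η : EReal) ≤ legendreK X P (X ω) ∧ (∫ x, X x ∂P) ≤ X ω}
      ≤ ENNReal.ofReal (Real.exp (-η)) := by
  refine measure_mem_le_of_forall_measure_ge_le
    (A := {x | (η : EReal) ≤ legendreK X P x ∧ (∫ ω, X ω ∂P) ≤ x})
    ⟨_, fun x hx ↦ hx.2⟩ fun x hx ↦ ?_
  rw [← ofReal_measureReal]
  exact ENNReal.ofReal_le_ofReal (measureReal_ge_le_exp_neg_of_le_legendreK hX hXi hx.1 hx.2)

theorem legendreK_neg {Ω : Type*} [MeasurableSpace Ω] (X : Ω → ℝ) (P : Measure Ω) (x : ℝ) :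
    legendreK (fun ω ↦ -X ω) P (-x) = legendreK X P x := by
  unfold legendreK mgfE
  rw [← (Equiv.neg ℝ).iSup_comp]
  simp

/-- Lemma 6.3 of Dümbgen–Wellner (supplement): let `X` be a real random variable whose
moment-generating function is finite in a neighborhood of `0`, let `μ = E X`, and let
`K(x) = sup_t ( t x − log m_X(t) )`.  Then for every `η > 0`:
`P(K(X) ≥ η, X ≥ μ) ≤ e^{−η}`, `P(K(X) ≥ η, X ≤ μ) ≤ e^{−η}`, and
`P(K(X) ≥ η) ≤ 2 e^{−η}`. -/
theorem stmt17
    {Ω : Type*} [MeasurableSpace Ω] (P : Measure Ω) [IsProbabilityMeasure P]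
    (X : Ω → ℝ) (hX : Measurable X)
    (hmgf : ∃ ε : ℝ, 0 < ε ∧ ∀ t : ℝ, |t| < ε → mgfE X P t < ⊤)
    (η : ℝ) (hη : 0 < η) :
    P {ω | (η : EReal) ≤ legendreK X P (X ω) ∧ (∫ x, X x ∂P) ≤ X ω}
        ≤ ENNReal.ofReal (Real.exp (-η)) ∧
    P {ω | (η : EReal) ≤ legendreK X P (X ω) ∧ X ω ≤ (∫ x, X x ∂P)}
        ≤ ENNReal.ofReal (Real.exp (-η)) ∧
    P {ω | (η : EReal) ≤ legendreK X P (X ω)} ≤ ENNReal.ofReal (2 * Real.exp (-η)) := by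
  have hXi := integrable_of_mgfE_lt_top hX hmgf
  have hupper := measure_le_legendreK_and_integral_le hX hXi η
  have hlower := measure_le_legendreK_and_integral_le hX.neg hXi.neg η
  simp only [Pi.neg_apply, integral_neg, neg_le_neg_iff] at hlower
  change P {ω | (η : EReal) ≤ legendreK (fun ω ↦ -X ω) P (-X ω) ∧ _} ≤ _ at hlower
  simp only [legendreK_neg] at hlower
  refine ⟨hupper, hlower, ?_⟩
  rw [two_mul, ENNReal.ofReal_add (Real.exp_pos _).le (Real.exp_pos _).le]
  refine (measure_mono fun ω hω ↦ ?_).trans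
    ((measure_union_le _ _).trans (add_le_add hupper hlower))
  exact (le_total (∫ x, X x ∂P) (X ω)).imp (⟨hω, ·⟩) (⟨hω, ·⟩)
end

section
/- Let 𝓕 be a nonempty set of distribution functions on ℝ that is convex (closed under convex combinations) and closed under translations, i.e. F(· − μ) ∈ 𝓕 for every F ∈ 𝓕 and μ ∈ ℝ. Let α ∈ (0,1), n ≥ 1, and let L_n, U_n : ℝ × ℝⁿ → ℝ be functions, non-decreasing in their first argument, such that all events below are measurable and such that for every F ∈ 𝓕, if X = (X_1,…,X_n) has i.i.d. components with distribution function F then P( L_n(x,X) ≤ F(x) ≤ U_n(x,X) for all x ∈ ℝ ) ≥ 1 − α. Then for every F ∈ 𝓕 and every ε ∈ (0,1), with X i.i.d. from F: P( inf_{x∈ℝ} U_n(x,X) < ε ) ≤ (1−ε)^{−n}·α and P( sup_{x∈ℝ} L_n(x,X) > 1−ε ) ≤ (1−ε)^{−n}·α. -/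
open MeasureTheory Set
open scoped ENNReal

/-- The distribution function of a Borel probability measure on ℝ. -/
noncomputable def df (μ : Measure ℝ) (x : ℝ) : ℝ := (μ (Set.Iic x)).toReal

lemma df_eq_cdf (μ : Measure ℝ) [IsProbabilityMeasure μ] :
    df μ = ProbabilityTheory.cdf μ := by
  ext x
  rw [ProbabilityTheory.cdf_eq_real]
  rfl

lemma df_map_add_const (μ : Measure ℝ) (c x : ℝ) :
    df (Measure.map (fun y => y + c) μ) x = df μ (x - c) := by
  rw [df, df, Measure.map_apply (measurable_add_const c) measurableSet_Iic]
  congr 2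
  ext y
  simp [le_sub_iff_add_le]

lemma df_mixture (μ ρ : Measure ℝ) [IsProbabilityMeasure μ] [IsProbabilityMeasure ρ]
    {p : ℝ} (hp0 : 0 ≤ p) (hp1 : p ≤ 1) (x : ℝ) :
    df (ENNReal.ofReal p • μ + ENNReal.ofReal (1 - p) • ρ) x
      = p * df μ x + (1 - p) * df ρ x := by
  simp only [df, Measure.add_apply, Measure.smul_apply, smul_eq_mul]
  rw [ENNReal.toReal_add (by finiteness) (by finiteness), ENNReal.toReal_mul,
    ENNReal.toReal_mul, ENNReal.toReal_ofReal hp0, ENNReal.toReal_ofReal (by linarith)]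

/-- If `a • μ ≤ ρ`, then `a ^ card ι • μ^{⊗ι} ≤ ρ^{⊗ι}`. -/
lemma pow_smul_pi_le_pi {ι X : Type*} [Fintype ι] [MeasurableSpace X] {μ ρ : Measure X}
    [SigmaFinite μ] {a : ℝ≥0∞} (h : a • μ ≤ ρ) :
    a ^ Fintype.card ι • Measure.pi (fun _ : ι => μ) ≤ Measure.pi (fun _ : ι => ρ) := by
  refine Measure.le_iff.2 fun s hs => ?_
  rw [Measure.pi_def (fun _ : ι => ρ), toMeasure_apply _ _ hs]
  suffices (a ^ Fintype.card ι • Measure.pi (fun _ : ι => μ)).toOuterMeasure ≤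
      OuterMeasure.pi fun _ : ι => ρ.toOuterMeasure from this s
  refine OuterMeasure.le_pi.2 fun t _ => ?_
  change (a ^ Fintype.card ι • Measure.pi (fun _ : ι => μ)) (univ.pi t) ≤ ∏ i, ρ (t i)
  rw [Measure.smul_apply, Measure.pi_pi, smul_eq_mul, Fintype.card, ← Finset.prod_const,
    ← Finset.prod_mul_distrib]
  exact Finset.prod_le_prod' fun i _ => h (t i)

/-- A set eventually covered by sets of measure at most `C` has measure at most `C`. -/
lemma measure_le_of_eventually_mem {X : Type*} [MeasurableSpace X] (m : Measure X)
    {A : Set X} {B : ℕ → Set X} {C : ℝ≥0∞} (hB : ∀ k, m (B k) ≤ C)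
    (hA : ∀ v ∈ A, ∀ᶠ k in Filter.atTop, v ∈ B k) : m A ≤ C := by
  have hsub : A ⊆ ⋃ j, ⋂ k ≥ j, B k := fun v hv => by
    simpa [Filter.eventually_atTop] using hA v hv
  have hmono : Monotone fun j => ⋂ k ≥ j, B k := fun i j hij =>
    biInter_subset_biInter_left fun k (hk : j ≤ k) => hij.trans hk
  refine (measure_mono hsub).trans ?_
  rw [hmono.measure_iUnion]
  exact iSup_le fun j => (measure_mono (biInter_subset_of_mem le_rfl)).trans (hB j)

/-- Quantitative version of Bahadur–Savage (Dümbgen–Wellner, Theorem 6.4 of the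
supplement).  `𝓕` is a nonempty family of (Borel probability measures with)
distribution functions on ℝ, convex and closed under translations.  `(L_n, U_n)` is a
`(1−α)`-confidence band for `F ∈ 𝓕` based on an i.i.d. sample of size `n` (modelled by
the product measure `μ^{⊗ n}` on `Fin n → ℝ`).  Then for every `F ∈ 𝓕` and
`ε ∈ (0,1)`: `P( inf_x U_n(x, X) < ε ) ≤ (1−ε)^{−n} α` and
`P( sup_x L_n(x, X) > 1−ε ) ≤ (1−ε)^{−n} α`  (the events `inf < ε` and `sup > 1−ε`
being expressed in the equivalent existential form). -/
theorem stmt18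
    (𝓕 : Set (Measure ℝ)) (h𝓕ne : 𝓕.Nonempty)
    (h𝓕prob : ∀ μ ∈ 𝓕, IsProbabilityMeasure μ)
    (h𝓕conv : ∀ μ ∈ 𝓕, ∀ ρ ∈ 𝓕, ∀ p : ℝ, 0 ≤ p → p ≤ 1 →
      ENNReal.ofReal p • μ + ENNReal.ofReal (1 - p) • ρ ∈ 𝓕)
    (h𝓕trans : ∀ μ ∈ 𝓕, ∀ c : ℝ, Measure.map (fun x => x + c) μ ∈ 𝓕)
    (α : ℝ) (hα : α ∈ Set.Ioo (0:ℝ) 1) (n : ℕ) (hn : 1 ≤ n)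
    (Ln Un : ℝ → (Fin n → ℝ) → ℝ)
    (hLmono : ∀ v : Fin n → ℝ, Monotone fun x => Ln x v)
    (hUmono : ∀ v : Fin n → ℝ, Monotone fun x => Un x v)
    (hmeas_band : ∀ μ ∈ 𝓕, MeasurableSet
      {v : Fin n → ℝ | ∀ x : ℝ, Ln x v ≤ df μ x ∧ df μ x ≤ Un x v})
    (hmeasU : ∀ ε : ℝ, MeasurableSet {v : Fin n → ℝ | ∃ x : ℝ, Un x v < ε})
    (hmeasL : ∀ ε : ℝ, MeasurableSet {v : Fin n → ℝ | ∃ x : ℝ, 1 - ε < Ln x v})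
    (hband : ∀ μ ∈ 𝓕,
      ENNReal.ofReal (1 - α) ≤ Measure.pi (fun _ : Fin n => μ)
        {v : Fin n → ℝ | ∀ x : ℝ, Ln x v ≤ df μ x ∧ df μ x ≤ Un x v}) :
    ∀ μ ∈ 𝓕, ∀ ε : ℝ, ε ∈ Set.Ioo (0:ℝ) 1 →
      Measure.pi (fun _ : Fin n => μ) {v : Fin n → ℝ | ∃ x : ℝ, Un x v < ε}
          ≤ ENNReal.ofReal (((1 - ε) ^ n)⁻¹ * α) ∧
      Measure.pi (fun _ : Fin n => μ) {v : Fin n → ℝ | ∃ x : ℝ, 1 - ε < Ln x v}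
          ≤ ENNReal.ofReal (((1 - ε) ^ n)⁻¹ * α) := by
  intro μ hμ ε ⟨hε0, hε1⟩
  have := h𝓕prob μ hμ
  have key : ∀ (c : ℕ → ℝ) (A : Set (Fin n → ℝ)),
      (∀ v ∈ A, ∀ᶠ k in Filter.atTop, ∃ x,
        (1 - ε) * df μ x + ε * df μ (x - c k) < Ln x v ∨
        Un x v < (1 - ε) * df μ x + ε * df μ (x - c k)) →
      Measure.pi (fun _ : Fin n => μ) A ≤ ENNReal.ofReal (((1 - ε) ^ n)⁻¹ * α) := by
    intro c A hA
    let ρ k := Measure.map (fun y => y + c k) μ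
    let G k := ENNReal.ofReal (1 - ε) • μ + ENNReal.ofReal (1 - (1 - ε)) • ρ k
    have hG k : G k ∈ 𝓕 :=
      h𝓕conv μ hμ (ρ k) (h𝓕trans μ hμ (c k)) _ (by linarith) (by linarith)
    have hdf k x : df (G k) x = (1 - ε) * df μ x + ε * df μ (x - c k) := by
      have := h𝓕prob (ρ k) (h𝓕trans μ hμ (c k))
      rw [df_mixture μ (ρ k) (by linarith) (by linarith), df_map_add_const, sub_sub_cancel]
    refine measure_le_of_eventually_mem _
      (B := fun k => {v | ∀ x, Ln x v ≤ df (G k) x ∧ df (G k) x ≤ Un x v}ᶜ) (fun k => ?_)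
      fun v hv => (hA v hv).mono ?_
    · have := h𝓕prob (G k) (hG k)
      set B := {v | ∀ x, Ln x v ≤ df (G k) x ∧ df (G k) x ≤ Un x v}ᶜ
      have hα' : Measure.pi (fun _ : Fin n => G k) B ≤ ENNReal.ofReal α := by
        rw [prob_compl_eq_one_sub (hmeas_band _ (hG k)), tsub_le_iff_right]
        calc (1 : ℝ≥0∞) = ENNReal.ofReal α + ENNReal.ofReal (1 - α) := by
              rw [← ENNReal.ofReal_add hα.1.le (by linarith [hα.2])]
              simp
          _ ≤ _ := by gcongr; exact hband _ (hG k)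
      have hpow := pow_smul_pi_le_pi (ι := Fin n)
        (show ENNReal.ofReal (1 - ε) • μ ≤ G k from Measure.le_add_right le_rfl) B
      rw [Measure.smul_apply, smul_eq_mul, Fintype.card_fin,
        ← ENNReal.ofReal_pow (by linarith)] at hpow
      have hpos : 0 < (1 - ε) ^ n := pow_pos (by linarith) n
      rw [ENNReal.ofReal_mul (inv_nonneg.2 hpos.le), ENNReal.ofReal_inv_of_pos hpos, mul_comm,
        ← div_eq_mul_inv, ENNReal.le_div_iff_mul_le (by simp [hpos]) (by simp), mul_comm]
      exact hpow.trans hα'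
    · rintro k ⟨x, hx⟩ hband_v
      have := hband_v x
      rw [hdf] at this
      rcases hx with hx | hx
      · exact hx.not_ge this.1
      · exact hx.not_ge this.2
  have hdf0 x : 0 ≤ df μ x := ENNReal.toReal_nonneg
  have hdf1 x : df μ x ≤ 1 := by
    rw [df_eq_cdf]
    exact ProbabilityTheory.cdf_le_one μ x
  constructor
  · refine key (fun k => -(k : ℝ)) _ ?_
    rintro v ⟨x, hx⟩
    have hlim : Filter.Tendsto (fun k : ℕ => ε * df μ (x - -(k : ℝ))) Filter.atTop
        (nhds (ε * 1)) := by
      rw [df_eq_cdf]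
      refine ((ProbabilityTheory.tendsto_cdf_atTop μ).comp ?_).const_mul ε
      simp only [sub_neg_eq_add]
      exact Filter.tendsto_atTop_add_const_left _ x tendsto_natCast_atTop_atTop
    filter_upwards [hlim.eventually_const_lt (by simpa using hx)] with k hk
    exact ⟨x, Or.inr (by nlinarith [hdf0 x])⟩
  · refine key (fun k => (k : ℝ)) _ ?_
    rintro v ⟨x, hx⟩
    have hlim : Filter.Tendsto (fun k : ℕ => (1 - ε) + ε * df μ (x - (k : ℝ))) Filter.atTop
        (nhds ((1 - ε) + ε * 0)) := by
      rw [df_eq_cdf]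
      refine (((ProbabilityTheory.tendsto_cdf_atBot μ).comp ?_).const_mul ε).const_add _
      simp only [sub_eq_add_neg]
      exact Filter.tendsto_atBot_add_const_left _ x
        (Filter.tendsto_neg_atTop_atBot.comp tendsto_natCast_atTop_atTop)
    filter_upwards [hlim.eventually_lt_const (by simpa using hx)] with k hk
    exact ⟨x, Or.inl (by nlinarith [hdf1 x])⟩
end
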